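/- arXiv:1204.6697 — 2 statements merged into one kernel-verified Lean document; each statement's English description precedes it below -/
import Mathlib

section
/- For every squarefree positive integer d with d ≠ 3, the Bianchi group PSL₂(O_d) splits as a nontrivial amalgamated free product: there exist groups A, B, C together with injective, non-surjective group homomorphisms f : C → A and g : C → B such that PSL₂(O_d) is isomorphic to the amalgamated free product A ∗_C B (the pushout of f and g in the category of groups). -/
open IntermediateField

/-- The imaginary quadratic field `ℚ(√-d)`, realized inside `ℂ`. -/
noncomputable abbrev Qd (d : ℕ) : IntermediateField ℚ ℂ :=
  ℚ⟮(Complex.I * (Real.sqrt d : ℂ) : ℂ)⟯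

/-- `O_d`: the ring of integers of the imaginary quadratic field `ℚ(√-d)`. -/
noncomputable abbrev Od (d : ℕ) : Type :=
  NumberField.RingOfIntegers (Qd d)

/-- `SL₂(R)`: the special linear group of 2×2 matrices over `R` of determinant 1. -/
abbrev SL2 (R : Type*) [CommRing R] : Type _ :=
  Matrix.SpecialLinearGroup (Fin 2) R

/-- `PSL₂(R)`: the quotient of `SL₂(R)` by its center. -/
abbrev PSL2 (R : Type*) [CommRing R] : Type _ :=
  SL2 R ⧸ Subgroup.center (SL2 R)

/-- The family over `Bool` sending `true` to `A` and `false` to `B`. -/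
abbrev AmalgamFam (A B : Type) : Bool → Type := fun i => Bool.rec B A i

instance (A B : Type) [Group A] [Group B] : ∀ i, Group (AmalgamFam A B i) := fun i =>
  Bool.rec (motive := fun i => Group (AmalgamFam A B i)) ‹Group B› ‹Group A› i

/-- The amalgamated free product `A ∗_C B` along `f : C →* A` and `g : C →* B`, realized
as the pushout of `f` and `g` in the category of groups (`Monoid.PushoutI` over the
two-element index type `Bool` is this pushout). -/
def AmalgamatedFreeProduct {A B C : Type} [Group A] [Group B] [Group C]
    (f : C →* A) (g : C →* B) : Type :=
  Monoid.PushoutI (fun i : Bool => Bool.rec (motive := fun i => C →* AmalgamFam A B i) g f i)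

instance {A B C : Type} [Group A] [Group B] [Group C] (f : C →* A) (g : C →* B) :
    Group (AmalgamatedFreeProduct f g) := by
  unfold AmalgamatedFreeProduct; infer_instance

section PingPong

open Monoid Monoid.PushoutI

theorem PushoutI.injective_of_pingPong {G : Bool → Type} {H K : Type} [∀ i, Group (G i)]
    [Group H] [Group K] {φ : ∀ i, H →* G i} (hφ : ∀ i, Function.Injective (φ i))
    (ℓ : PushoutI φ →* K) (S : Set K)
    (hbase : ∀ h, ℓ (base φ h) = 1 → h = 1)
    (hone : ∀ a, ℓ (of true a) = 1 → a ∈ (φ true).range)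
    (hA : ∀ a, ℓ (of true a) ∉ S)
    (hBS : ∀ b ∉ (φ false).range, ∀ x ∉ S, ℓ (of false b) * x ∈ S)
    (hAS : ∀ a ∉ (φ true).range, ∀ x ∈ S, ℓ (of true a) * x ∉ S)
    (hCS : ∀ c, ∀ x ∈ S, ℓ (base φ c) * x ∈ S) :
    Function.Injective ℓ := by
  classical
  obtain ⟨D⟩ := NormalWord.transversal_nonempty φ hφ
  have hbS : ∀ c, ℓ (base φ c) ∉ S := fun c => by
    rw [← of_apply_eq_base φ true]; exact hA _
  have key : ∀ w : NormalWord D,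
      (w.fstIdx = none → ∃ h, w.prod = base φ h) ∧
      (w.fstIdx = some false → ℓ w.prod ∈ S) ∧
      (w.fstIdx = some true → ∃ a ∉ (φ true).range,
        ℓ w.prod = ℓ (of true a) ∨ ∃ x ∈ S, ℓ w.prod = ℓ (of true a) * x) := by
    intro w
    induction w using NormalWord.consRecOn with
    | empty => exact ⟨fun _ => ⟨1, by simp⟩, fun h => by simp [CoprodI.Word.fstIdx] at h,
        fun h => by simp [CoprodI.Word.fstIdx] at h⟩
    | cons i g w hmw hgn hgr hw1 ih =>
      obtain ⟨ih0, ih1, ih2⟩ := ih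
      have hi : (NormalWord.cons g w hmw hgr).fstIdx = some i := by
        simp [CoprodI.Word.fstIdx, NormalWord.cons, CoprodI.Word.cons]
      rw [hi, NormalWord.prod_cons, map_mul]
      refine ⟨fun h => by simp at h, fun h => ?_, fun h => ?_⟩
      · obtain rfl : i = false := by simpa using h
        refine hBS g hgr _ ?_
        rcases hf : w.fstIdx with _ | (_ | _)
        · obtain ⟨c, hc⟩ := ih0 hf
          rw [hc]; exact hbS c
        · exact absurd hf hmw
        · obtain ⟨a, ha, h1 | ⟨x, hx, h1⟩⟩ := ih2 hf
          · rw [h1]; exact hA a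
          · rw [h1]; exact hAS a ha x hx
      · obtain rfl : i = true := by simpa using h
        rcases hf : w.fstIdx with _ | (_ | _)
        · obtain ⟨c, hc⟩ := ih0 hf
          refine ⟨g * φ true c, ?_, Or.inl ?_⟩
          · rwa [mul_mem_cancel_right (MonoidHom.mem_range.2 ⟨c, rfl⟩)]
          · rw [hc, map_mul, map_mul, of_apply_eq_base]
        · exact ⟨g, hgr, Or.inr ⟨_, ih1 hf, rfl⟩⟩
        · exact absurd hf hmw
    | base c w hw1 ih =>
      obtain ⟨ih0, ih1, ih2⟩ := ih
      have hi : (base φ c • w).fstIdx = w.fstIdx := by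
        rw [NormalWord.base_smul_def]
      rw [hi, NormalWord.prod_smul, map_mul]
      refine ⟨fun h => ?_, fun h => hCS c _ (ih1 h), fun h => ?_⟩
      · obtain ⟨c', hc⟩ := ih0 h
        exact ⟨c * c', by rw [hc, map_mul]⟩
      · obtain ⟨a, ha, h1⟩ := ih2 h
        refine ⟨φ true c * a, ?_, ?_⟩
        · rwa [mul_mem_cancel_left (MonoidHom.mem_range.2 ⟨c, rfl⟩)]
        · rw [map_mul, map_mul, of_apply_eq_base]
          rcases h1 with h1 | ⟨x, hx, h1⟩
          · exact Or.inl (by rw [h1])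
          · exact Or.inr ⟨x, hx, by rw [h1, mul_assoc]⟩
  rw [injective_iff_map_eq_one]
  intro p hp
  obtain ⟨w, rfl⟩ : ∃ w : NormalWord D, w.prod = p :=
    ⟨NormalWord.equiv p, NormalWord.equiv.symm_apply_apply p⟩
  obtain ⟨k0, k1, k2⟩ := key w
  have h1S : (1 : K) ∉ S := by simpa using hbS 1
  rcases hf : w.fstIdx with _ | (_ | _)
  · obtain ⟨c, hc⟩ := k0 hf
    rw [hc] at hp ⊢
    rw [hbase c hp, map_one]
  · exact absurd (hp ▸ k1 hf) h1S
  · obtain ⟨a, ha, h1 | ⟨x, hx, h1⟩⟩ := k2 hf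
    · exact absurd (hone a (h1 ▸ hp)) ha
    · have hx' : x = ℓ (of true a⁻¹) := by
        rw [map_inv, map_inv]; exact eq_inv_of_mul_eq_one_right (h1 ▸ hp)
      exact absurd (hx' ▸ hx) (hA _)

/-- A group generated by two subgroups that play ping-pong is their amalgam. -/
theorem exists_amalgam_of_pingPong {G : Type} [Group G] (A B : Subgroup G) (S : Set G)
    (hA : ∀ a ∈ A, a ∉ S)
    (hBS : ∀ b ∈ B, b ∉ A → ∀ x ∉ S, b * x ∈ S)
    (hAS : ∀ a ∈ A, a ∉ B → ∀ x ∈ S, a * x ∉ S)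
    (hCS : ∀ c ∈ A, c ∈ B → ∀ x ∈ S, c * x ∈ S)
    (hgen : A ⊔ B = ⊤) (hAB : ¬ A ≤ B) (hBA : ¬ B ≤ A) :
    ∃ (A B C : GrpCat) (f : C →* A) (g : C →* B),
      Function.Injective f ∧ ¬ Function.Surjective f ∧
      Function.Injective g ∧ ¬ Function.Surjective g ∧
      Nonempty (G ≃* AmalgamatedFreeProduct f g) := by
  let f : (A ⊓ B : Subgroup G) →* A := Subgroup.inclusion inf_le_left
  let g : (A ⊓ B : Subgroup G) →* B := Subgroup.inclusion inf_le_right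
  let φ : ∀ i : Bool, (A ⊓ B : Subgroup G) →* AmalgamFam A B i := fun i =>
    Bool.rec (motive := fun i => (A ⊓ B : Subgroup G) →* AmalgamFam A B i) g f i
  let e : ∀ i : Bool, AmalgamFam A B i →* G := fun i =>
    Bool.rec (motive := fun i => AmalgamFam A B i →* G) B.subtype A.subtype i
  have he : ∀ i, (e i).comp (φ i) = (A ⊓ B).subtype := by rintro (_ | _) <;> rfl
  let ℓ : PushoutI φ →* G := PushoutI.lift e (A ⊓ B).subtype he
  have hfi : Function.Injective f := Subgroup.inclusion_injective _
  have hgi : Function.Injective g := Subgroup.inclusion_injective _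
  have hrA : ∀ a : A, a ∈ f.range ↔ (a : G) ∈ B := fun a =>
    ⟨by rintro ⟨c, rfl⟩; exact c.2.2, fun h => ⟨⟨a, a.2, h⟩, rfl⟩⟩
  have hrB : ∀ b : B, b ∈ g.range ↔ (b : G) ∈ A := fun b =>
    ⟨by rintro ⟨c, rfl⟩; exact c.2.1, fun h => ⟨⟨b, h, b.2⟩, rfl⟩⟩
  have hℓA : ∀ a : A, ℓ (of (φ := φ) true a) = a := fun a => PushoutI.lift_of e _ he (i := true) a
  have hℓB : ∀ b : B, ℓ (of (φ := φ) false b) = b := fun b =>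
    PushoutI.lift_of e _ he (i := false) b
  have hℓC : ∀ c, ℓ (base φ c) = c := fun c => PushoutI.lift_base e _ he c
  have hinj : Function.Injective ℓ := by
    refine PushoutI.injective_of_pingPong (by rintro (_ | _) <;> assumption) ℓ S ?_ ?_ ?_ ?_ ?_ ?_
    · intro h hh
      rw [hℓC] at hh
      exact_mod_cast hh
    · intro a ha
      refine (hrA a).2 ?_
      rw [← hℓA a, ha]; exact B.one_mem
    · intro a; rw [hℓA a]; exact hA _ a.2
    · intro b hb x hx
      rw [hℓB b]; exact hBS _ b.2 (fun h => hb ((hrB b).2 h)) x hx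
    · intro a ha x hx
      rw [hℓA a]; exact hAS _ a.2 (fun h => ha ((hrA a).2 h)) x hx
    · intro c x hx
      rw [hℓC]; exact hCS _ c.2.1 c.2.2 x hx
  have hsurj : Function.Surjective ℓ := by
    rw [← MonoidHom.range_eq_top, eq_top_iff, ← hgen, sup_le_iff]
    exact ⟨fun a ha => ⟨_, hℓA ⟨a, ha⟩⟩, fun b hb => ⟨_, hℓB ⟨b, hb⟩⟩⟩
  refine ⟨GrpCat.of A, GrpCat.of B, GrpCat.of (A ⊓ B : Subgroup G), f, g, hfi, fun h => hAB ?_,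
    hgi, fun h => hBA ?_, ⟨(MulEquiv.ofBijective ℓ ⟨hinj, hsurj⟩).symm⟩⟩
  · exact fun a ha => (hrA ⟨a, ha⟩).1 (h _)
  · exact fun b hb => (hrB ⟨b, hb⟩).1 (h _)

end PingPong

section Walls

/-- A `G`-invariant system of pairwise nested walls. Each wall `v` is oriented: `side v g` is
an integer whose sign says on which side of `v` the point `g` lies. -/
structure WallSystem (G V : Type) [Group G] [AddCommGroup V] where
  /-- the action of the group on the ambient lattice of walls -/
  act : G →* (V ≃ₗ[ℤ] V)
  /-- the signed position of a point of `G` relative to a wall -/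
  side : V → G → ℤ
  /-- the walls of the system -/
  walls : Set V
  side_act : ∀ h v g, side (act h v) (h * g) = side v g
  side_neg : ∀ v g, side (-v) g = -side v g
  act_mem : ∀ g, ∀ v ∈ walls, act g v ∈ walls
  neg_mem : ∀ v ∈ walls, -v ∈ walls
  side_ne_zero : ∀ v ∈ walls, ∀ g, side v g ≠ 0
  nested : ∀ v ∈ walls, ∀ v' ∈ walls, v' = v ∨ v' = -v ∨
    (∀ g, side v g < side v' g) ∨ (∀ g, side v' g < side v g) ∨
    (∀ g, 0 < side v g + side v' g) ∨ (∀ g, side v g + side v' g < 0)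

namespace WallSystem

variable {G V : Type} [Group G] [AddCommGroup V] (W : WallSystem G V)

/-- `T` is innermost among the walls having `y` on their negative side. -/
def Simple (T : V) (y : G) : Prop :=
  T ∈ W.walls ∧ W.side T y < 0 ∧
    ∀ U ∈ W.walls, W.side U y < 0 → ¬ ∀ g, W.side T g < W.side U g

theorem act_mul (g h : G) (v : V) : W.act (g * h) v = W.act g (W.act h v) := by
  rw [map_mul]; rfl

theorem act_one (v : V) : W.act 1 v = v := by
  rw [map_one]; rfl

theorem act_inv_of_eq {g : G} {v w : V} (h : W.act g v = w) : W.act g⁻¹ w = v := by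
  rw [← h, ← act_mul, inv_mul_cancel, act_one]

theorem side_mul (h : G) (v : V) (g : G) : W.side v (h * g) = W.side (W.act h⁻¹ v) g := by
  rw [← W.side_act h (W.act h⁻¹ v) g, ← act_mul, mul_inv_cancel, act_one]

/-- The stabilizer of the chamber of `1`. -/
def chamber : Subgroup G where
  carrier := {g | ∀ U ∈ W.walls, W.side U g < 0 ↔ W.side U 1 < 0}
  one_mem' := fun _ _ => Iff.rfl
  mul_mem' := by
    intro a b ha hb U hU
    rw [side_mul, hb _ (W.act_mem _ _ hU), ← ha U hU, ← side_mul, mul_one]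
  inv_mem' := by
    intro a ha U hU
    have h1 := W.side_act a U 1
    rw [mul_one] at h1
    rw [← W.side_act a U a⁻¹, mul_inv_cancel, ← h1]
    exact (ha _ (W.act_mem a U hU)).symm

theorem mem_chamber {g : G} :
    g ∈ W.chamber ↔ ∀ U ∈ W.walls, W.side U g < 0 ↔ W.side U 1 < 0 := Iff.rfl

theorem exists_simple (P : V → Prop) (hex : ∃ U ∈ W.walls, W.side U 1 < 0 ∧ P U)
    (hup : ∀ U U', P U → (∀ g, W.side U g < W.side U' g) → P U') :
    ∃ T, W.Simple T 1 ∧ P T := by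
  classical
  have hex' : ∃ n : ℕ, ∃ U ∈ W.walls, W.side U 1 < 0 ∧ P U ∧ (W.side U 1).natAbs = n := by
    obtain ⟨U, h1, h2, h3⟩ := hex
    exact ⟨_, U, h1, h2, h3, rfl⟩
  obtain ⟨T, h1, h2, h3, h4⟩ := Nat.find_spec hex'
  refine ⟨T, ⟨h1, h2, fun U hU hU1 hlt => ?_⟩, h3⟩
  have := hlt 1
  exact Nat.find_min hex' (m := (W.side U 1).natAbs) (by omega) ⟨U, hU, hU1, hup _ _ h3 hlt, rfl⟩

variable {W}

theorem Simple.act {T : V} {y : G} (hT : W.Simple T y) (h : G) :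
    W.Simple (W.act h T) (h * y) := by
  obtain ⟨h1, h2, h3⟩ := hT
  refine ⟨W.act_mem _ _ h1, by rwa [side_act], fun U hU hUy hlt => ?_⟩
  rw [side_mul] at hUy
  refine h3 _ (W.act_mem _ _ hU) hUy fun g => ?_
  have := hlt (h * g)
  rwa [side_act, side_mul] at this

theorem Simple.of_mem_chamber {T : V} {a : G} (hT : W.Simple T 1) (ha : a ∈ W.chamber) :
    W.Simple T a := by
  obtain ⟨h1, h2, h3⟩ := hT
  exact ⟨h1, (ha T h1).2 h2, fun U hU hUa => h3 U hU ((ha U hU).1 hUa)⟩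

theorem Simple.of_act_mem_chamber {T : V} {a : G} (hT : W.Simple T a) (ha : a ∈ W.chamber) :
    W.Simple T 1 := by
  obtain ⟨h1, h2, h3⟩ := hT
  exact ⟨h1, (ha T h1).1 h2, fun U hU hUa => h3 U hU ((ha U hU).2 hUa)⟩

theorem Simple.side_neg_of_side_neg {T : V} {x y : G} (hx : W.Simple T x) (hy : W.Simple T y)
    {U : V} (hU : U ∈ W.walls) (hUx : W.side U x < 0) : W.side U y < 0 := by
  by_contra hUy
  have hUy' := W.side_ne_zero U hU y
  have hUn := W.side_neg U
  have h1 := hx.2.1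
  have h2 := hy.2.1
  rcases W.nested T hx.1 U hU with rfl | rfl | h | h | h | h
  · omega
  · have := W.side_neg T x; omega
  · exact hx.2.2 U hU hUx h
  · have := h y; omega
  · have := h x; omega
  · refine hy.2.2 (-U) (W.neg_mem U hU) (by rw [hUn]; omega) fun g => ?_
    have := h g
    rw [hUn]; omega

theorem Simple.mem_chamber {T : V} {g : G} (h1 : W.Simple T 1) (hg : W.Simple T g) :
    g ∈ W.chamber := fun _ hU =>
  ⟨hg.side_neg_of_side_neg h1 hU, h1.side_neg_of_side_neg hg hU⟩

theorem Simple.add_neg {T T' : V} (hT : W.Simple T 1) (hT' : W.Simple T' 1) (hne : T' ≠ T)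
    (g : G) : W.side T g + W.side T' g < 0 := by
  have h1 := hT.2.1
  have h2 := hT'.2.1
  rcases W.nested T hT.1 T' hT'.1 with h | h | h | h | h | h
  · exact absurd h hne
  · have := W.side_neg T 1; rw [h] at h2; omega
  · exact absurd h (hT.2.2 T' hT'.1 h2)
  · exact absurd h (hT'.2.2 T hT.1 h1)
  · have := h 1; omega
  · exact h g

variable (W)

theorem exists_simple_separating {g : G} (hg : g ∉ W.chamber) :
    ∃ T, W.Simple T 1 ∧ 0 < W.side T g := by
  refine W.exists_simple (fun T => 0 < W.side T g) ?_ (fun U U' h h' => h.trans (h' g))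
  rw [W.mem_chamber] at hg
  push Not at hg
  obtain ⟨U, hU, h | h⟩ := hg
  · have h1 := W.side_ne_zero U hU 1
    exact ⟨-U, W.neg_mem U hU, by rw [W.side_neg]; omega, by rw [W.side_neg]; omega⟩
  · have h1 := W.side_ne_zero U hU g
    exact ⟨U, hU, h.2, by omega⟩

/-- The stabilizer of an unoriented wall. -/
def stabilizer (v : V) : Subgroup G where
  carrier := {g | W.act g v = v ∨ W.act g v = -v}
  one_mem' := Or.inl (W.act_one _)
  mul_mem' := by
    rintro a b (ha | ha) (hb | hb)
    · exact Or.inl (by rw [act_mul, hb, ha])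
    · exact Or.inr (by rw [act_mul, hb, map_neg, ha])
    · exact Or.inr (by rw [act_mul, hb, ha])
    · exact Or.inl (by rw [act_mul, hb, map_neg, ha, neg_neg])
  inv_mem' := by
    rintro a (ha | ha)
    · exact Or.inl (W.act_inv_of_eq ha)
    · refine Or.inr (W.act_inv_of_eq ?_)
      rw [map_neg, ha, neg_neg]

theorem mem_stabilizer {v : V} {g : G} :
    g ∈ W.stabilizer v ↔ W.act g v = v ∨ W.act g v = -v := Iff.rfl

/-- A single orbit of pairwise nested walls, one of which is inverted by some element and
which is not reduced to one wall, gives an amalgam decomposition. -/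
theorem exists_amalgam (v₀ : V) (htrans : ∀ v ∈ W.walls, ∃ g, W.act g v₀ = v)
    (hv₀ : v₀ ∈ W.walls) (j t : G) (hj : W.act j v₀ = -v₀)
    (ht : W.act t v₀ ≠ v₀) (ht' : W.act t v₀ ≠ -v₀) :
    ∃ (A B C : GrpCat) (f : C →* A) (g : C →* B),
      Function.Injective f ∧ ¬ Function.Surjective f ∧
      Function.Injective g ∧ ¬ Function.Surjective g ∧
      Nonempty (G ≃* AmalgamatedFreeProduct f g) := by
  obtain ⟨v₁, hv₁, -⟩ := W.exists_simple (fun _ => True) (by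
    rcases lt_or_gt_of_ne (W.side_ne_zero v₀ hv₀ 1) with h | h
    · exact ⟨v₀, hv₀, h, trivial⟩
    · exact ⟨-v₀, W.neg_mem _ hv₀, by rw [W.side_neg]; omega, trivial⟩) (fun _ _ _ _ => trivial)
  obtain ⟨p, hp⟩ := htrans v₁ hv₁.1
  have hp' : W.act p⁻¹ v₁ = v₀ := W.act_inv_of_eq hp
  have hj₁ : W.act (p * j * p⁻¹) v₁ = -v₁ := by rw [act_mul, act_mul, hp', hj, map_neg, hp]
  have hj₁B : p * j * p⁻¹ ∈ W.stabilizer v₁ := Or.inr hj₁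
  have hv₁neg := hv₁.2.1
  have hgen : ∀ n : ℕ, ∀ g T, W.Simple T 1 → 0 < W.side T g → (W.side T g).natAbs = n →
      g ∈ W.chamber ⊔ W.stabilizer v₁ := by
    intro n
    induction n using Nat.strong_induction_on with
    | _ n ih =>
    intro g T hT hTg hn
    obtain ⟨r, hr⟩ := htrans T hT.1
    obtain ⟨q, hq⟩ : ∃ q, W.act q v₁ = T := ⟨r * p⁻¹, by rw [act_mul, hp', hr]⟩
    have hqA : q ∈ W.chamber := hT.mem_chamber (by simpa [hq] using hv₁.act q)
    set j' := q * (p * j * p⁻¹) * q⁻¹ with hj'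
    have hj'T : W.act j' T = -T := by
      rw [hj', act_mul, act_mul, W.act_inv_of_eq hq, hj₁, map_neg, hq]
    have hj'mem : j' ∈ W.chamber ⊔ W.stabilizer v₁ := mul_mem (mul_mem
      (Subgroup.mem_sup_left hqA) (Subgroup.mem_sup_right hj₁B))
      (inv_mem (Subgroup.mem_sup_left hqA))
    suffices h : j'⁻¹ * g ∈ W.chamber ⊔ W.stabilizer v₁ by
      simpa using mul_mem hj'mem h
    by_cases hA : j'⁻¹ * g ∈ W.chamber
    · exact Subgroup.mem_sup_left hA
    obtain ⟨T', hT', hT'g⟩ := W.exists_simple_separating hA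
    have e : W.side T (j'⁻¹ * g) = -W.side T g := by rw [side_mul, inv_inv, hj'T, side_neg]
    have hne : T' ≠ T := by rintro rfl; omega
    have := hT.add_neg hT' hne (j'⁻¹ * g)
    exact ih (W.side T' (j'⁻¹ * g)).natAbs (by omega) _ T' hT' hT'g rfl
  have htop : W.chamber ⊔ W.stabilizer v₁ = ⊤ := by
    rw [eq_top_iff]
    intro g _
    by_cases hA : g ∈ W.chamber
    · exact Subgroup.mem_sup_left hA
    obtain ⟨T, hT, hTg⟩ := W.exists_simple_separating hA
    exact hgen _ g T hT hTg rfl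
  refine exists_amalgam_of_pingPong W.chamber (W.stabilizer v₁) {g | 0 < W.side v₁ g}
    ?_ ?_ ?_ ?_ htop ?_ ?_
  · intro a ha h
    have := (ha v₁ hv₁.1).2 hv₁neg
    simp only [Set.mem_ofPred_eq] at h
    omega
  · intro b hb hbA x hx
    have hx0 := W.side_ne_zero v₁ hv₁.1 x
    simp only [Set.mem_ofPred_eq] at hx ⊢
    rcases hb with hb | hb
    · exact absurd (hv₁.mem_chamber (by simpa [hb] using hv₁.act b)) hbA
    · have : W.act b⁻¹ v₁ = -v₁ := W.act_inv_of_eq (by rw [map_neg, hb, neg_neg])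
      rw [side_mul, this, side_neg]; omega
  · intro a ha haB x hx
    simp only [Set.mem_ofPred_eq] at hx ⊢
    rw [side_mul]
    have hT : W.Simple (W.act a⁻¹ v₁) 1 := by
      simpa using (hv₁.of_mem_chamber ha).act a⁻¹
    have hne : W.act a⁻¹ v₁ ≠ v₁ := fun h =>
      haB (inv_mem_iff.1 (show a⁻¹ ∈ W.stabilizer v₁ from Or.inl h))
    have := hv₁.add_neg hT hne x
    omega
  · intro c hcA hcB x hx
    simp only [Set.mem_ofPred_eq] at hx ⊢
    rcases hcB with hc | hc
    · rw [side_mul, W.act_inv_of_eq hc]; exact hx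
    · have h1 := (hcA v₁ hv₁.1).2 hv₁neg
      have : W.act c⁻¹ v₁ = -v₁ := W.act_inv_of_eq (by rw [map_neg, hc, neg_neg])
      rw [← mul_one c, side_mul, this, side_neg] at h1
      omega
  · intro hAB
    rw [sup_eq_right.2 hAB] at htop
    have hm : p * t * p⁻¹ ∈ W.stabilizer v₁ := htop ▸ Subgroup.mem_top _
    rw [mem_stabilizer, act_mul, act_mul, hp'] at hm
    rcases hm with h | h
    · exact ht (by rw [← W.act_inv_of_eq h, hp'])
    · exact ht' (by rw [← W.act_inv_of_eq h, map_neg, hp'])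
  · intro hBA
    have h1 := (hBA hj₁B v₁ hv₁.1).2 hv₁neg
    rw [← mul_one (p * j * p⁻¹), side_mul,
      W.act_inv_of_eq (v := -v₁) (by rw [map_neg, hj₁, neg_neg]), side_neg] at h1
    omega

/-- Words in the reflections `s h` in simple walls without two equal consecutive letters,
the first letter being recorded. -/
inductive Reduced (s : V → G) : V → G → Prop
  | single {h : V} (hh : W.Simple h 1) : Reduced s h (s h)
  | cons {h h' : V} {w : G} (hh : W.Simple h 1) (hne : h' ≠ h) (hw : Reduced s h' w) :
      Reduced s h (s h * w)

/-- If every wall carries a reflection, then folding along the walls is a retraction of the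
group onto the stabilizer of the chamber of `1`. -/
theorem exists_fold (s : V → G) (hss : ∀ h ∈ W.walls, s h * s h = 1)
    (hsneg : ∀ h ∈ W.walls, W.act (s h) h = -h)
    (hsconj : ∀ h ∈ W.walls, ∀ g, g * s h * g⁻¹ = s (W.act g h))
    (N : G → ℕ) (hN : ∀ h ∈ W.walls, W.side h 1 < 0 → ∀ g, 0 < W.side h g → N (s h * g) < N g) :
    ∃ π : G →* G, (∀ g, π g ∈ W.chamber) ∧ (∀ q ∈ W.chamber, π q = q) ∧
      ∀ q ∈ W.chamber, ∀ h, W.Simple h 1 → π (q * s h) = q := by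
  have hsinv : ∀ h ∈ W.walls, (s h)⁻¹ = s h := fun h hh =>
    inv_eq_of_mul_eq_one_left (hss h hh)
  have hside : ∀ h ∈ W.walls, ∀ g, W.side h (s h * g) = -W.side h g := fun h hh g => by
    rw [side_mul, hsinv h hh, hsneg h hh, side_neg]
  let R : Subgroup G := Subgroup.closure {r | ∃ h, W.Simple h 1 ∧ s h = r}
  have hsR : ∀ h, W.Simple h 1 → s h ∈ R := fun h hh => Subgroup.subset_closure ⟨h, hh, rfl⟩
  have hex : ∀ n : ℕ, ∀ g, N g = n → ∃ q ∈ W.chamber, q * g⁻¹ ∈ R := by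
    intro n
    induction n using Nat.strong_induction_on with
    | _ n ih =>
    intro g hg
    by_cases hA : g ∈ W.chamber
    · exact ⟨g, hA, by simp⟩
    obtain ⟨h, hh, hhg⟩ := W.exists_simple_separating hA
    obtain ⟨q, hq, hqR⟩ := ih _ (hg ▸ hN h hh.1 hh.2.1 g hhg) (s h * g) rfl
    refine ⟨q, hq, ?_⟩
    have := mul_mem hqR (hsR h hh)
    rwa [mul_inv_rev, ← mul_assoc, inv_mul_cancel_right] at this
  have hred_side : ∀ h w, W.Reduced s h w → 0 < W.side h w := by
    intro h w hw
    induction hw with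
    | @single h hh =>
      have h1 := hh.2.1
      have h2 := hside h hh.1 1
      rw [mul_one] at h2
      omega
    | @cons h h' w hh hne hw ih =>
      have h0 : W.Simple h' 1 := by cases hw <;> assumption
      have h1 := hh.add_neg h0 hne w
      have h2 := hside h hh.1 w
      omega
  have hred : ∀ w ∈ R, w = 1 ∨ ∃ h, W.Reduced s h w := by
    intro w hw
    have step : ∀ h, W.Simple h 1 → ∀ w, (w = 1 ∨ ∃ h, W.Reduced s h w) →
        (s h * w = 1 ∨ ∃ h', W.Reduced s h' (s h * w)) := by
      rintro h hh w (rfl | ⟨h', hw⟩)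
      · exact Or.inr ⟨h, by rw [mul_one]; exact .single hh⟩
      · by_cases hne : h' = h
        · subst hne
          cases hw with
          | single => exact Or.inl (hss _ hh.1)
          | @cons _ h'' w' _ hne hw =>
            rw [← mul_assoc, hss _ hh.1, one_mul]
            exact Or.inr ⟨h'', hw⟩
        · exact Or.inr ⟨h, .cons hh hne hw⟩
    induction hw using Subgroup.closure_induction_left with
    | one => exact Or.inl rfl
    | mul_left x hx y hy ih =>
      obtain ⟨h, hh, rfl⟩ := hx
      exact step h hh y ih
    | inv_mul_cancel x hx y hy ih =>
      obtain ⟨h, hh, rfl⟩ := hx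
      rw [hsinv h hh.1]
      exact step h hh y ih
  have hRA : ∀ w ∈ R, w ∈ W.chamber → w = 1 := by
    intro w hw hwA
    rcases hred w hw with h | ⟨h, hh⟩
    · exact h
    · have h1 := hred_side h w hh
      have h0 : W.Simple h 1 := by cases hh <;> assumption
      have h2 := (hwA h h0.1).2 h0.2.1
      omega
  have hnorm : ∀ q ∈ W.chamber, ∀ w ∈ R, q * w * q⁻¹ ∈ R := by
    intro q hq w hw
    induction hw using Subgroup.closure_induction with
    | mem x hx =>
      obtain ⟨h, hh, rfl⟩ := hx
      rw [hsconj h hh.1]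
      refine hsR _ (Simple.of_act_mem_chamber (a := q) ?_ hq)
      simpa using hh.act q
    | one => simp
    | mul x y _ _ hx hy => simpa [mul_assoc] using mul_mem hx hy
    | inv x _ hx => simpa [mul_assoc] using inv_mem hx
  choose π hπA hπR using fun g => hex _ g rfl
  have huniq : ∀ g, ∀ q ∈ W.chamber, q * g⁻¹ ∈ R → π g = q := by
    intro g q hq hqR
    have h1 := mul_mem (hπR g) (inv_mem hqR)
    rw [mul_inv_rev, inv_inv, ← mul_assoc, inv_mul_cancel_right] at h1
    exact eq_of_mul_inv_eq_one (hRA _ h1 (mul_mem (hπA g) (inv_mem hq)))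
  refine ⟨MonoidHom.mk' π fun g g' => ?_, hπA, fun q hq => ?_, fun q hq h hh => ?_⟩
  · refine huniq _ _ (mul_mem (hπA g) (hπA g')) ?_
    have := mul_mem (hnorm _ (hπA g) _ (hπR g')) (hπR g)
    simpa [mul_assoc] using this
  · exact huniq _ _ hq (by simp)
  · refine huniq _ _ hq ?_
    have := hnorm q hq _ (inv_mem (hsR h hh))
    simpa [mul_assoc] using this

end WallSystem

end Walls

section HermitianAction

open Matrix

variable {R : Type} [CommRing R]

/-- The element of `SL₂(R)` with the given entries. -/
def SL2.ofEntries (p q r s : R) (h : p * s - q * r = 1) : SL2 R :=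
  ⟨!![p, q; r, s], by rw [det_fin_two_of, h]⟩

theorem SL2.exists_ofEntries (g : SL2 R) : ∃ p q r s h, g = SL2.ofEntries p q r s h :=
  ⟨g.1 0 0, g.1 0 1, g.1 1 0, g.1 1 1, by rw [← det_fin_two, g.2], Subtype.ext (eta_fin_two g.1)⟩

/-- The polarization of the determinant of `2 × 2` matrices. -/
def polarDet (M N : Matrix (Fin 2) (Fin 2) R) : R :=
  M 0 0 * N 1 1 + N 0 0 * M 1 1 - M 0 1 * N 1 0 - N 0 1 * M 1 0

theorem polarDet_eq (M N : Matrix (Fin 2) (Fin 2) R) :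
    polarDet M N = (M + N).det - M.det - N.det := by
  simp only [polarDet, det_fin_two, Matrix.add_apply]; ring

theorem polarDet_neg (M N : Matrix (Fin 2) (Fin 2) R) : polarDet (-M) N = -polarDet M N := by
  simp only [polarDet, Matrix.neg_apply]; ring

variable [StarRing R]

/-- The action `M ↦ g M gᴴ` of `SL₂(R)` on `2 × 2` matrices. -/
def congrAct : SL2 R →* (Matrix (Fin 2) (Fin 2) R ≃ₗ[ℤ] Matrix (Fin 2) (Fin 2) R) :=
  MonoidHom.mk' (fun g =>
    { toFun := fun M => g.1 * M * g.1ᴴ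
      invFun := fun M => (g⁻¹).1 * M * (g⁻¹).1ᴴ
      map_add' := fun M N => by rw [mul_add, add_mul]
      map_smul' := fun c M => by
        rw [Matrix.mul_smul, Matrix.smul_mul]; rfl
      left_inv := fun M => by
        have h : (g⁻¹).1 * g.1 = 1 := congrArg Subtype.val (inv_mul_cancel g)
        calc (g⁻¹).1 * (g.1 * M * g.1ᴴ) * (g⁻¹).1ᴴ
            = ((g⁻¹).1 * g.1) * M * ((g⁻¹).1 * g.1)ᴴ := by
              rw [conjTranspose_mul]; simp only [Matrix.mul_assoc]
          _ = M := by rw [h]; simp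
      right_inv := fun M => by
        have h : g.1 * (g⁻¹).1 = 1 := congrArg Subtype.val (mul_inv_cancel g)
        calc g.1 * ((g⁻¹).1 * M * (g⁻¹).1ᴴ) * g.1ᴴ
            = (g.1 * (g⁻¹).1) * M * (g.1 * (g⁻¹).1)ᴴ := by
              rw [conjTranspose_mul]; simp only [Matrix.mul_assoc]
          _ = M := by rw [h]; simp })
    (fun g h => by
      ext1 M
      change (g.1 * h.1) * M * (g.1 * h.1)ᴴ = g.1 * (h.1 * M * h.1ᴴ) * g.1ᴴ
      rw [conjTranspose_mul]; simp only [Matrix.mul_assoc])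

theorem congrAct_apply (g : SL2 R) (M : Matrix (Fin 2) (Fin 2) R) :
    congrAct g M = g.1 * M * g.1ᴴ := rfl

theorem congrAct_ofEntries (p q r s : R) (h : p * s - q * r = 1) (a b c d : R) :
    congrAct (SL2.ofEntries p q r s h) !![a, b; c, d] =
      !![p * a * star p + q * c * star p + p * b * star q + q * d * star q,
         p * a * star r + q * c * star r + p * b * star s + q * d * star s;
         r * a * star p + s * c * star p + r * b * star q + s * d * star q,
         r * a * star r + s * c * star r + r * b * star s + s * d * star s] := by
  rw [congrAct_apply, SL2.ofEntries]
  ext i j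
  fin_cases i <;> fin_cases j <;>
    simp [Matrix.mul_apply, Fin.sum_univ_two, conjTranspose_apply] <;> ring

theorem det_congrAct (g : SL2 R) (M : Matrix (Fin 2) (Fin 2) R) :
    (congrAct g M).det = M.det := by
  rw [congrAct_apply, det_mul, det_mul, det_conjTranspose, g.2]; simp

theorem polarDet_congrAct (g : SL2 R) (M N : Matrix (Fin 2) (Fin 2) R) :
    polarDet (congrAct g M) (congrAct g N) = polarDet M N := by
  rw [polarDet_eq, polarDet_eq, ← map_add, det_congrAct, det_congrAct, det_congrAct]

theorem conjTranspose_congrAct (g : SL2 R) (M : Matrix (Fin 2) (Fin 2) R) :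
    (congrAct g M)ᴴ = congrAct g Mᴴ := by
  simp only [congrAct_apply, conjTranspose_mul, conjTranspose_conjTranspose, Matrix.mul_assoc]

end HermitianAction

section Lorentzian

/-- The reverse Cauchy–Schwarz inequality: a nonzero vector in the closed future cone is
negative against every vector in the open future cone. -/
theorem lorentz_neg {b k δ : ℤ} (hD : 0 < 4 * k - b ^ 2) (hδ : 0 < δ) {a c m n a' c' m' n' : ℤ}
    (ha : 0 ≤ a) (hc : 0 ≤ c) (hac : 0 < a + c)
    (hq : m ^ 2 + b * m * n + k * n ^ 2 ≤ δ * (a * c)) (ha' : 0 < a')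
    (hq' : m' ^ 2 + b * m' * n' + k * n' ^ 2 < δ * (a' * c')) :
    2 * m * m' + b * (m * n' + m' * n) + 2 * k * n * n' < δ * (a * c' + a' * c) := by
  have posN : ∀ m n : ℤ, 0 ≤ m ^ 2 + b * m * n + k * n ^ 2 := fun m n => by
    nlinarith [sq_nonneg (2 * m + b * n), mul_nonneg hD.le (sq_nonneg n)]
  have hc' : 0 < c' := by
    have h1 : 0 < δ * (a' * c') := (posN m' n').trans_lt hq'
    exact pos_of_mul_pos_right (pos_of_mul_pos_right h1 hδ.le) ha'.le
  have hpos : 0 < a * c' + a' * c := by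
    rcases ha.eq_or_lt with h | h
    · have : 0 < c := by omega
      nlinarith [mul_pos ha' this, mul_nonneg ha hc'.le]
    · nlinarith [mul_pos h hc', mul_nonneg ha'.le hc]
  set N := m ^ 2 + b * m * n + k * n ^ 2 with hN
  set N' := m' ^ 2 + b * m' * n' + k * n' ^ 2 with hN'
  have hcs : (2 * m * m' + b * (m * n' + m' * n) + 2 * k * n * n') ^ 2 ≤ 4 * N * N' := by
    have e : 4 * N * N' - (2 * m * m' + b * (m * n' + m' * n) + 2 * k * n * n') ^ 2
        = (4 * k - b ^ 2) * (m * n' - m' * n) ^ 2 := by rw [hN, hN']; ring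
    have := mul_nonneg hD.le (sq_nonneg (m * n' - m' * n))
    linarith
  have hle : 4 * N * N' < (δ * (a * c' + a' * c)) ^ 2 := by
    have h1 : 4 * (δ * (a * c)) * (δ * (a' * c')) ≤ (δ * (a * c' + a' * c)) ^ 2 := by
      nlinarith [mul_nonneg (sq_nonneg δ) (sq_nonneg (a * c' - a' * c))]
    have h0 : 0 ≤ δ * (a * c) := (posN m n).trans hq
    rcases h0.eq_or_lt with h | h
    · have hN0 : N = 0 := le_antisymm (by rw [h]; exact hq) (posN m n)
      rw [hN0]
      simpa using pow_pos (mul_pos hδ hpos) 2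
    · have h2 : N * N' ≤ δ * (a * c) * N' := mul_le_mul_of_nonneg_right hq (posN m' n')
      have h3 : δ * (a * c) * N' < δ * (a * c) * (δ * (a' * c')) := mul_lt_mul_of_pos_left hq' h
      linarith
  exact lt_of_pow_lt_pow_left₀ 2 (mul_pos hδ hpos).le (hcs.trans_lt hle)

/-- A nonzero causal vector has constant sign against the open future cone. -/
theorem lorentz_sign {b k δ : ℤ} (hD : 0 < 4 * k - b ^ 2) (hδ : 0 < δ) {a c m n : ℤ}
    (hne : ¬ (a = 0 ∧ c = 0 ∧ m = 0 ∧ n = 0))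
    (hq : m ^ 2 + b * m * n + k * n ^ 2 ≤ δ * (a * c)) :
    (∀ a' c' m' n' : ℤ, 0 < a' → m' ^ 2 + b * m' * n' + k * n' ^ 2 < δ * (a' * c') →
      2 * m * m' + b * (m * n' + m' * n) + 2 * k * n * n' - δ * (a * c' + a' * c) < 0) ∨
    (∀ a' c' m' n' : ℤ, 0 < a' → m' ^ 2 + b * m' * n' + k * n' ^ 2 < δ * (a' * c') →
      0 < 2 * m * m' + b * (m * n' + m' * n) + 2 * k * n * n' - δ * (a * c' + a' * c)) := by
  have e4 : 4 * (m ^ 2 + b * m * n + k * n ^ 2) = (2 * m + b * n) ^ 2 + (4 * k - b ^ 2) * n ^ 2 := by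
    ring
  have hn0 := mul_nonneg hD.le (sq_nonneg n)
  have h0 : 0 ≤ a * c := by
    by_contra h
    nlinarith [sq_nonneg (2 * m + b * n), mul_pos hδ (neg_pos.2 (not_le.1 h))]
  have hac : a ≠ 0 ∨ c ≠ 0 := by
    by_contra h
    push Not at h
    obtain ⟨rfl, rfl⟩ := h
    simp only [mul_zero] at hq
    have hn : n = 0 := by
      by_contra hn
      nlinarith [sq_nonneg (2 * m + b * n), mul_pos hD (pow_pos (abs_pos.2 hn) 2), sq_abs n]
    subst hn
    have : m = 0 := by
      simp only [mul_zero, add_zero, ne_eq, OfNat.ofNat_ne_zero, not_false_eq_true, zero_pow] at hq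
      exact pow_eq_zero_iff two_ne_zero |>.1 (le_antisymm hq (sq_nonneg m))
    exact hne ⟨rfl, rfl, this, rfl⟩
  have hsign : (0 ≤ a ∧ 0 ≤ c) ∨ (a ≤ 0 ∧ c ≤ 0) := by
    rcases mul_nonneg_iff.1 h0 with h | h <;> simp [h]
  rcases hsign with ⟨ha, hc⟩ | ⟨ha, hc⟩
  · left
    intro a' c' m' n' ha' hq'
    have := lorentz_neg hD hδ ha hc (by omega) hq ha' hq'
    linarith
  · right
    intro a' c' m' n' ha' hq'
    have := lorentz_neg (m := -m) (n := -n) hD hδ (neg_nonneg.2 ha) (neg_nonneg.2 hc) (by omega)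
      (by simpa using hq) ha' hq'
    linarith

end Lorentzian

section EvenDiscriminant

open Matrix

variable {d : ℤ}

/-- The Hermitian matrix with diagonal `2a`, `2c` and upper right entry `y + 2zω` over the
order `ℤ[√-d]`. -/
def evenHerm (d a c y z : ℤ) : Matrix (Fin 2) (Fin 2) (QuadraticAlgebra ℤ (-d) 0) :=
  !![⟨2 * a, 0⟩, ⟨y, 2 * z⟩; ⟨y, -2 * z⟩, ⟨2 * c, 0⟩]

theorem evenHerm_det (a c y z : ℤ) :
    (evenHerm d a c y z).det.re = 4 * (a * c) - (y ^ 2 + 4 * d * z ^ 2) := by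
  simp [evenHerm, det_fin_two_of]; ring

theorem evenHerm_polarDet (a c y z a' c' y' z' : ℤ) :
    (polarDet (evenHerm d a c y z) (evenHerm d a' c' y' z')).re =
      4 * (a * c' + a' * c) - (2 * y * y' + 2 * (4 * d) * z * z') := by
  simp [evenHerm, polarDet]; ring

theorem evenHerm_neg (a c y z : ℤ) : -evenHerm d a c y z = evenHerm d (-a) (-c) (-y) (-z) := by
  simp [evenHerm]

theorem congrAct_evenHerm (s : SL2 (QuadraticAlgebra ℤ (-d) 0)) (a c y z : ℤ) (hy : Odd y) :
    ∃ a' c' y' z', Odd y' ∧ congrAct s (evenHerm d a c y z) = evenHerm d a' c' y' z' ∧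
      (0 < d → 0 < a → y ^ 2 + 4 * d * z ^ 2 < 4 * (a * c) → 0 < a') := by
  obtain ⟨⟨p₁, p₂⟩, ⟨q₁, q₂⟩, ⟨r₁, r₂⟩, ⟨s₁, s₂⟩, h, rfl⟩ := SL2.exists_ofEntries s
  have hre := congrArg QuadraticAlgebra.re h
  have him := congrArg QuadraticAlgebra.im h
  simp [QuadraticAlgebra.re_one, QuadraticAlgebra.im_one] at hre him
  refine ⟨a * (p₁ ^ 2 + d * p₂ ^ 2) + c * (q₁ ^ 2 + d * q₂ ^ 2) + y * (p₁ * q₁ + d * p₂ * q₂)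
      + 2 * d * z * (p₁ * q₂ - p₂ * q₁),
    a * (r₁ ^ 2 + d * r₂ ^ 2) + c * (s₁ ^ 2 + d * s₂ ^ 2) + y * (r₁ * s₁ + d * r₂ * s₂)
      + 2 * d * z * (r₁ * s₂ - r₂ * s₁),
    y + 2 * (a * (p₁ * r₁ + d * p₂ * r₂) + c * (q₁ * s₁ + d * q₂ * s₂)
      + d * z * (p₁ * s₂ - p₂ * s₁ - q₁ * r₂ + q₂ * r₁) + y * (q₁ * r₁ + d * p₂ * s₂)),
    a * (p₂ * r₁ - p₁ * r₂) + c * (q₂ * s₁ - q₁ * s₂)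
      + z * (p₁ * s₁ + d * p₂ * s₂ - q₁ * r₁ - d * q₂ * r₂) + y * (q₂ * r₁ - p₁ * s₂),
    ?_, ?_, ?_⟩
  · exact hy.add_even ⟨_, two_mul _⟩
  · rw [evenHerm, congrAct_ofEntries, evenHerm]
    ext i j <;> fin_cases i <;> fin_cases j <;> simp
    · ring
    · linear_combination y * hre
    · linear_combination y * hre
    · ring
    · ring
    · linear_combination y * him
    · linear_combination (-y) * him
    · ring
  · intro hd ha hq
    set a' := a * (p₁ ^ 2 + d * p₂ ^ 2) + c * (q₁ ^ 2 + d * q₂ ^ 2) + y * (p₁ * q₁ + d * p₂ * q₂)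
      + 2 * d * z * (p₁ * q₂ - p₂ * q₁) with ha'
    have key : 4 * (a * a') = (2 * a * p₁ + y * q₁ + 2 * d * z * q₂) ^ 2
        + d * (2 * a * p₂ + y * q₂ - 2 * z * q₁) ^ 2
        + (q₁ ^ 2 + d * q₂ ^ 2) * (4 * (a * c) - (y ^ 2 + 4 * d * z ^ 2)) := by
      rw [ha']; ring
    by_contra hneg
    have h1 : a * a' ≤ 0 := mul_nonpos_of_nonneg_of_nonpos ha.le (not_lt.1 hneg)
    have h2 := sq_nonneg (2 * a * p₁ + y * q₁ + 2 * d * z * q₂)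
    have h3 := mul_nonneg hd.le (sq_nonneg (2 * a * p₂ + y * q₂ - 2 * z * q₁))
    have h4 : q₁ ^ 2 + d * q₂ ^ 2 ≤ 0 := by
      by_contra h
      have := mul_pos (not_le.1 h) (sub_pos.2 hq)
      linarith
    have h5 := mul_nonneg hd.le (sq_nonneg q₂)
    have hq₁ : q₁ = 0 := pow_eq_zero_iff two_ne_zero |>.1
      (le_antisymm (by linarith) (sq_nonneg q₁))
    have hq₂ : q₂ = 0 := by
      have : d * q₂ ^ 2 = 0 := le_antisymm (by linarith [sq_nonneg q₁]) h5
      exact pow_eq_zero_iff two_ne_zero |>.1 ((mul_eq_zero.1 this).resolve_left hd.ne')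
    subst hq₁ hq₂
    simp only [mul_zero, add_zero, sub_zero] at h2 h3 key
    have hp₁ : 2 * a * p₁ = 0 := pow_eq_zero_iff two_ne_zero |>.1
      (le_antisymm (by nlinarith) h2)
    have hp₂ : 2 * a * p₂ = 0 := by
      have : d * (2 * a * p₂) ^ 2 = 0 := le_antisymm (by nlinarith) h3
      exact pow_eq_zero_iff two_ne_zero |>.1 ((mul_eq_zero.1 this).resolve_left hd.ne')
    have ha2 : 2 * a ≠ 0 := by omega
    have hp₁' := (mul_eq_zero.1 hp₁).resolve_left ha2
    have hp₂' := (mul_eq_zero.1 hp₂).resolve_left ha2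
    subst hp₁' hp₂'
    simp at hre

/-- A group acting on `2 × 2` matrices over `ℤ[√-d]` through the transformations
`M ↦ g M gᴴ`, and through all of them, is an amalgam. -/
theorem exists_amalgam_of_even (hd : 0 < d) {G : Type} [Group G]
    (α : G →* (Matrix (Fin 2) (Fin 2) (QuadraticAlgebra ℤ (-d) 0) ≃ₗ[ℤ]
      Matrix (Fin 2) (Fin 2) (QuadraticAlgebra ℤ (-d) 0)))
    (hα : ∀ g, ∃ s, α g = congrAct s) (hα' : ∀ s, ∃ g, α g = congrAct s) :
    ∃ (A B C : GrpCat) (f : C →* A) (g : C →* B),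
      Function.Injective f ∧ ¬ Function.Surjective f ∧
      Function.Injective g ∧ ¬ Function.Surjective g ∧
      Nonempty (G ≃* AmalgamatedFreeProduct f g) := by
  have hpoint : ∀ g, ∃ a c y z, Odd y ∧ 0 < a ∧ y ^ 2 + 4 * d * z ^ 2 < 4 * (a * c) ∧
      α g (evenHerm d 1 1 1 0) = evenHerm d a c y z := by
    intro g
    obtain ⟨s, hs⟩ := hα g
    obtain ⟨a, c, y, z, hy, he, ha⟩ := congrAct_evenHerm s 1 1 1 0 odd_one
    refine ⟨a, c, y, z, hy, ha hd one_pos (by norm_num), ?_, by rw [hs, he]⟩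
    have h := det_congrAct s (evenHerm d 1 1 1 0)
    have h' := congrArg QuadraticAlgebra.re h
    rw [he, evenHerm_det, evenHerm_det] at h'
    linarith
  have hwall : ∀ g, ∃ a c y z, Odd y ∧ y ^ 2 + 4 * d * z ^ 2 = 4 * (a * c) + 1 ∧
      α g (evenHerm d 0 0 1 0) = evenHerm d a c y z := by
    intro g
    obtain ⟨s, hs⟩ := hα g
    obtain ⟨a, c, y, z, hy, he, -⟩ := congrAct_evenHerm s 0 0 1 0 odd_one
    refine ⟨a, c, y, z, hy, ?_, by rw [hs, he]⟩
    have h := det_congrAct s (evenHerm d 0 0 1 0)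
    have h' := congrArg QuadraticAlgebra.re h
    rw [he, evenHerm_det, evenHerm_det] at h'
    linarith
  have hmul : ∀ g h M, α (g * h) M = α g (α h M) := fun g h M => by rw [map_mul]; rfl
  have hinv : ∀ h M N, (polarDet (α h M) (α h N)).re = (polarDet M N).re := by
    intro h M N
    obtain ⟨s, hs⟩ := hα h
    rw [hs, polarDet_congrAct]
  obtain ⟨j, hj⟩ := hα' (SL2.ofEntries 0 (-1) 1 0 (by simp))
  obtain ⟨t, ht⟩ := hα' (SL2.ofEntries 1 1 0 1 (by simp))
  have hjv : α j (evenHerm d 0 0 1 0) = -evenHerm d 0 0 1 0 := by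
    rw [hj, evenHerm, congrAct_ofEntries]
    ext i j <;> fin_cases i <;> fin_cases j <;> simp
  have htv : α t (evenHerm d 0 0 1 0) = evenHerm d 1 0 1 0 := by
    rw [ht, evenHerm, congrAct_ofEntries, evenHerm]
    ext i j <;> fin_cases i <;> fin_cases j <;> simp
  let W : WallSystem G (Matrix (Fin 2) (Fin 2) (QuadraticAlgebra ℤ (-d) 0)) :=
    { act := α
      side := fun v g => -(polarDet v (α g (evenHerm d 1 1 1 0))).re
      walls := Set.range fun g => α g (evenHerm d 0 0 1 0)
      side_act := fun h v g => by rw [hmul, hinv]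
      side_neg := fun v g => by rw [polarDet_neg, QuadraticAlgebra.re_neg]
      act_mem := by
        rintro g _ ⟨h, rfl⟩
        exact ⟨g * h, hmul _ _ _⟩
      neg_mem := by
        rintro _ ⟨h, rfl⟩
        exact ⟨h * j, by simp only; rw [hmul, hjv, map_neg]⟩
      side_ne_zero := by
        rintro _ ⟨h, rfl⟩ g
        obtain ⟨a, c, y, z, hy, -, e⟩ := hwall h
        obtain ⟨a', c', y', z', hy', -, -, e'⟩ := hpoint g
        simp only [e, e', evenHerm_polarDet]
        obtain ⟨u, hu⟩ := hy.mul hy'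
        intro h0
        have : 2 * (a * c' + a' * c) - 2 * d * z * z' * 2 = y * y' := by linarith
        rw [hu] at this
        have e2 : 2 * d * z * z' * 2 = 2 * (2 * d * z * z') := by ring
        omega
      nested := by
        rintro _ ⟨h, rfl⟩ _ ⟨h', rfl⟩
        obtain ⟨a, c, y, z, hy, hq, e⟩ := hwall h
        obtain ⟨a', c', y', z', hy', hq', e'⟩ := hwall h'
        simp only [e, e']
        have hmod : ∃ u, 2 * y * y' + 2 * (4 * d) * z * z' - 4 * (a * c' + a' * c) = 4 * u + 2 := by
          obtain ⟨u, hu⟩ := hy.mul hy'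
          exact ⟨u + 2 * d * z * z' - (a * c' + a' * c), by linear_combination 2 * hu⟩
        obtain ⟨u, hu⟩ := hmod
        by_cases hpos : 0 ≤ u
        · by_cases heq : a' - a = 0 ∧ c' - c = 0 ∧ y' - y = 0 ∧ z' - z = 0
          · left
            obtain ⟨h1, h2, h3, h4⟩ := heq
            rw [sub_eq_zero.1 h1, sub_eq_zero.1 h2, sub_eq_zero.1 h3, sub_eq_zero.1 h4]
          have hs := lorentz_sign (b := 0) (k := 4 * d) (δ := 4) (by linarith) (by norm_num) heq
            (by linarith)
          rcases hs with hs | hs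
          · refine Or.inr (Or.inr (Or.inr (Or.inl fun g => ?_)))
            obtain ⟨A, C, Y, Z, -, hA, hQ, E⟩ := hpoint g
            have := hs A C Y Z hA (by linarith)
            rw [E, evenHerm_polarDet, evenHerm_polarDet]
            linarith
          · refine Or.inr (Or.inr (Or.inl fun g => ?_))
            obtain ⟨A, C, Y, Z, -, hA, hQ, E⟩ := hpoint g
            have := hs A C Y Z hA (by linarith)
            rw [E, evenHerm_polarDet, evenHerm_polarDet]
            linarith
        · by_cases heq : a' + a = 0 ∧ c' + c = 0 ∧ y' + y = 0 ∧ z' + z = 0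
          · right; left
            obtain ⟨h1, h2, h3, h4⟩ := heq
            rw [evenHerm_neg, eq_neg_of_add_eq_zero_left h1, eq_neg_of_add_eq_zero_left h2,
              eq_neg_of_add_eq_zero_left h3, eq_neg_of_add_eq_zero_left h4]
          have hs := lorentz_sign (b := 0) (k := 4 * d) (δ := 4) (by linarith) (by norm_num) heq
            (by linarith [Int.not_le.1 hpos])
          rcases hs with hs | hs
          · refine Or.inr (Or.inr (Or.inr (Or.inr (Or.inr fun g => ?_))))
            obtain ⟨A, C, Y, Z, -, hA, hQ, E⟩ := hpoint g
            have := hs A C Y Z hA (by linarith)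
            rw [E, evenHerm_polarDet, evenHerm_polarDet]
            linarith
          · refine Or.inr (Or.inr (Or.inr (Or.inr (Or.inl fun g => ?_))))
            obtain ⟨A, C, Y, Z, -, hA, hQ, E⟩ := hpoint g
            have := hs A C Y Z hA (by linarith)
            rw [E, evenHerm_polarDet, evenHerm_polarDet]
            linarith }
  refine W.exists_amalgam (evenHerm d 0 0 1 0) (fun v hv => hv) ⟨1, by simp⟩ j t hjv ?_ ?_
  · change α t _ ≠ _
    rw [htv]
    intro h
    have := congrArg QuadraticAlgebra.re (congrFun (congrFun h 0) 0)
    simp [evenHerm] at this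
  · change α t _ ≠ _
    rw [htv]
    intro h
    have := congrArg QuadraticAlgebra.re (congrFun (congrFun h 0) 0)
    simp [evenHerm] at this

end EvenDiscriminant

section OddDiscriminant

open Matrix

/-- `2 × 2` matrices over the order `ℤ[ω]`, where `ω² = ω - k`. -/
abbrev OddMat (k : ℤ) : Type := Matrix (Fin 2) (Fin 2) (QuadraticAlgebra ℤ (-k) 1)

variable {k : ℤ}

/-- The skew-Hermitian matrix with diagonal `a(2ω - 1)`, `c(2ω - 1)` and upper right entry
`m + nω`. -/
def oddSkew (k a c m n : ℤ) : OddMat k :=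
  !![⟨-a, 2 * a⟩, ⟨m, n⟩; ⟨-m - n, n⟩, ⟨-c, 2 * c⟩]

/-- The polarization of the determinant, as an integral form. -/
def oddForm (M N : OddMat k) : ℤ := (polarDet M N).re

/-- The trace of the upper right entry. -/
def oddTrace (M : OddMat k) : ℤ := 2 * (M 0 1).re + (M 0 1).im

theorem oddSkew_conjTranspose (a c m n : ℤ) : (oddSkew k a c m n)ᴴ = -oddSkew k a c m n := by
  ext i j <;> fin_cases i <;> fin_cases j <;> simp [oddSkew] <;> ring

theorem exists_oddSkew {M : OddMat k} (h : Mᴴ = -M) : ∃ a c m n, M = oddSkew k a c m n := by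
  have h00 := congrFun (congrFun h 0) 0
  have h11 := congrFun (congrFun h 1) 1
  have h10 := congrFun (congrFun h 1) 0
  rw [conjTranspose_apply, QuadraticAlgebra.ext_iff] at h00 h11 h10
  simp at h00 h11 h10
  refine ⟨-(M 0 0).re, -(M 1 1).re, (M 0 1).re, (M 0 1).im, ?_⟩
  ext i j <;> fin_cases i <;> fin_cases j <;> simp [oddSkew] <;> linarith

theorem oddForm_oddSkew (a c m n a' c' m' n' : ℤ) :
    oddForm (oddSkew k a c m n) (oddSkew k a' c' m' n') =
      2 * m * m' + 1 * (m * n' + m' * n) + 2 * k * n * n' - (4 * k - 1) * (a * c' + a' * c) := by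
  simp [oddForm, oddSkew, polarDet]; ring

theorem oddTrace_oddSkew (a c m n : ℤ) : oddTrace (oddSkew k a c m n) = 2 * m + n := by
  simp [oddTrace, oddSkew]

theorem oddSkew_zero_zero (a c m n : ℤ) : (oddSkew k a c m n 0 0).re = -a := by
  simp [oddSkew]

theorem oddForm_comm (M N : OddMat k) : oddForm M N = oddForm N M := by
  rw [oddForm, oddForm]; congr 1; simp only [polarDet]; ring

theorem oddForm_add (M N N' : OddMat k) : oddForm M (N + N') = oddForm M N + oddForm M N' := by
  rw [oddForm, oddForm, oddForm, ← QuadraticAlgebra.re_add]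
  congr 1; simp only [polarDet, Matrix.add_apply]; ring

theorem oddForm_smul (c : ℤ) (M N : OddMat k) : oddForm M (c • N) = c * oddForm M N := by
  rw [oddForm, oddForm, ← smul_eq_mul, ← QuadraticAlgebra.re_smul]
  congr 1; simp only [polarDet, Matrix.smul_apply, zsmul_eq_mul]; ring

theorem oddForm_neg (M N : OddMat k) : oddForm M (-N) = -oddForm M N := by
  simpa using oddForm_smul (-1) M N

theorem oddForm_sub (M N N' : OddMat k) : oddForm M (N - N') = oddForm M N - oddForm M N' := by
  rw [sub_eq_add_neg, oddForm_add, oddForm_neg, sub_eq_add_neg]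

theorem two_mul_oddForm {M N : OddMat k} (hM : Mᴴ = -M) (hN : Nᴴ = -N) :
    4 * k - 1 ∣ 2 * oddForm M N - oddTrace M * oddTrace N := by
  obtain ⟨a, c, m, n, rfl⟩ := exists_oddSkew hM
  obtain ⟨a', c', m', n', rfl⟩ := exists_oddSkew hN
  rw [oddForm_oddSkew, oddTrace_oddSkew, oddTrace_oddSkew]
  exact ⟨n * n' - 2 * (a * c' + a' * c), by ring⟩

/-- The future cone: skew-Hermitian matrices of negative norm with positive first coordinate. -/
def OddFuture (M : OddMat k) : Prop := Mᴴ = -M ∧ oddForm M M < 0 ∧ (M 0 0).re < 0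

theorem oddForm_neg_of_future (hk : 2 ≤ k) {M N : OddMat k} (hM : OddFuture M)
    (hN : OddFuture N) : oddForm M N < 0 := by
  obtain ⟨hM, hM1, hM2⟩ := hM
  obtain ⟨hN, hN1, hN2⟩ := hN
  obtain ⟨a, c, m, n, rfl⟩ := exists_oddSkew hM
  obtain ⟨a', c', m', n', rfl⟩ := exists_oddSkew hN
  rw [oddForm_oddSkew] at hM1 hN1 ⊢
  rw [oddSkew_zero_zero] at hM2 hN2
  have hpos : 0 ≤ m ^ 2 + 1 * m * n + k * n ^ 2 := by nlinarith [sq_nonneg (2 * m + n)]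
  have h1 : m ^ 2 + 1 * m * n + k * n ^ 2 < (4 * k - 1) * (a * c) := by linarith
  have hc : 0 ≤ c := by
    have h0 : 0 < (4 * k - 1) * (a * c) := hpos.trans_lt h1
    exact (pos_of_mul_pos_right (pos_of_mul_pos_right h0 (by omega)) (by omega)).le
  have := lorentz_neg (b := 1) (k := k) (δ := 4 * k - 1) (by linarith) (by linarith)
    (a := a) (c := c) (m := m) (n := n) (by omega) hc (by omega) h1.le
    (a' := a') (c' := c') (m' := m') (n' := n') (by omega) (by linarith)
  linarith

/-- A nonzero causal vector has constant sign on the future cone. -/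
theorem oddForm_sign_of_causal (hk : 2 ≤ k) {u : OddMat k} (hu : uᴴ = -u) (hne : u ≠ 0)
    (hq : oddForm u u ≤ 0) :
    (∀ N, OddFuture N → oddForm u N < 0) ∨ (∀ N, OddFuture N → 0 < oddForm u N) := by
  obtain ⟨a, c, m, n, rfl⟩ := exists_oddSkew hu
  rw [oddForm_oddSkew] at hq
  have hs := lorentz_sign (b := 1) (k := k) (δ := 4 * k - 1) (by linarith) (by linarith)
    (a := a) (c := c) (m := m) (n := n) (by
      rintro ⟨rfl, rfl, rfl, rfl⟩
      exact hne (by ext i j <;> fin_cases i <;> fin_cases j <;> simp [oddSkew])) (by linarith)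
  rcases hs with hs | hs
  · left
    rintro N ⟨hN, h1, h2⟩
    obtain ⟨a', c', m', n', rfl⟩ := exists_oddSkew hN
    rw [oddForm_oddSkew] at h1 ⊢
    rw [oddSkew_zero_zero] at h2
    exact hs a' c' m' n' (by omega) (by linarith)
  · right
    rintro N ⟨hN, h1, h2⟩
    obtain ⟨a', c', m', n', rfl⟩ := exists_oddSkew hN
    rw [oddForm_oddSkew] at h1 ⊢
    rw [oddSkew_zero_zero] at h2
    exact hs a' c' m' n' (by omega) (by linarith)

/-- Isometries of the lattice of skew-Hermitian matrices that preserve the future cone and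
multiply the trace of the upper right entry by a sign modulo the discriminant. -/
structure OddIsometry (g : OddMat k ≃ₗ[ℤ] OddMat k) : Prop where
  form : ∀ M N, oddForm (g M) (g N) = oddForm M N
  skew : ∀ M, Mᴴ = -M → (g M)ᴴ = -g M
  future : ∀ M, OddFuture M → (g M 0 0).re < 0
  trace : ∃ ε : ℤ, (ε = 1 ∨ ε = -1) ∧ ∀ M, Mᴴ = -M →
    4 * k - 1 ∣ oddTrace (g M) - ε * oddTrace M

/-- The group of isometries `OddIsometry`. -/
def oddIsometryGroup (k : ℤ) : Subgroup (OddMat k ≃ₗ[ℤ] OddMat k) where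
  carrier := {g | OddIsometry g ∧ OddIsometry g⁻¹}
  one_mem' := by
    have : OddIsometry (1 : OddMat k ≃ₗ[ℤ] OddMat k) :=
      ⟨fun _ _ => rfl, fun _ h => h, fun _ h => h.2.2, 1, Or.inl rfl, fun M _ => by simp⟩
    exact ⟨this, by simpa using this⟩
  mul_mem' := by
    have key : ∀ g h : OddMat k ≃ₗ[ℤ] OddMat k, OddIsometry g → OddIsometry h →
        OddIsometry (g * h) := by
      intro g h hg hh
      refine ⟨fun M N => by simp [hg.form, hh.form], fun M hM => hg.skew _ (hh.skew _ hM),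
        fun M hM => hg.future _ ⟨hh.skew _ hM.1, (hh.form M M).trans_lt hM.2.1, hh.future _ hM⟩, ?_⟩
      obtain ⟨ε, hε, h1⟩ := hg.trace
      obtain ⟨ε', hε', h2⟩ := hh.trace
      refine ⟨ε * ε', by rcases hε with rfl | rfl <;> rcases hε' with rfl | rfl <;> simp,
        fun M hM => ?_⟩
      have := dvd_add (h1 _ (hh.skew _ hM)) ((h2 M hM).mul_left ε)
      have e : oddTrace (g (h M)) - ε * ε' * oddTrace M = oddTrace (g (h M)) - ε * oddTrace (h M)
          + ε * (oddTrace (h M) - ε' * oddTrace M) := by ring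
      exact e ▸ this
    rintro g h ⟨hg, hg'⟩ ⟨hh, hh'⟩
    exact ⟨key g h hg hh, by rw [_root_.mul_inv_rev]; exact key _ _ hh' hg'⟩
  inv_mem' := by
    rintro g ⟨hg, hg'⟩
    exact ⟨hg', by rwa [inv_inv]⟩

theorem congrAct_mem_oddIsometryGroup (hk : 2 ≤ k) (s : SL2 (QuadraticAlgebra ℤ (-k) 1)) :
    congrAct s ∈ oddIsometryGroup k := by
  suffices h : ∀ s : SL2 (QuadraticAlgebra ℤ (-k) 1), OddIsometry (congrAct s) from
    ⟨h s, by rw [← map_inv]; exact h s⁻¹⟩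
  clear s
  intro s
  refine ⟨fun M N => by rw [oddForm, polarDet_congrAct, oddForm],
    fun M hM => by rw [conjTranspose_congrAct, hM, map_neg], ?_, 1, Or.inl rfl, ?_⟩
  · rintro M ⟨hM, hq, ha⟩
    obtain ⟨a, c, m, n, rfl⟩ := exists_oddSkew hM
    rw [oddForm_oddSkew] at hq
    rw [oddSkew_zero_zero] at ha
    obtain ⟨⟨p₁, p₂⟩, ⟨q₁, q₂⟩, ⟨r₁, r₂⟩, ⟨s₁, s₂⟩, h, rfl⟩ := SL2.exists_ofEntries s
    have hre := congrArg QuadraticAlgebra.re h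
    simp [QuadraticAlgebra.re_one] at hre
    rw [oddSkew, congrAct_ofEntries]
    have posN : ∀ x y : ℤ, 0 ≤ x ^ 2 + x * y + k * y ^ 2 := fun x y => by
      nlinarith [sq_nonneg (2 * x + y), sq_nonneg y]
    have zeroN : ∀ x y : ℤ, x ^ 2 + x * y + k * y ^ 2 = 0 → x = 0 ∧ y = 0 := fun x y h0 => by
      have hy : y = 0 := pow_eq_zero_iff two_ne_zero |>.1
        (le_antisymm (by nlinarith [sq_nonneg (2 * x + y), sq_nonneg y]) (sq_nonneg y))
      subst hy
      exact ⟨pow_eq_zero_iff two_ne_zero |>.1 (by linarith), rfl⟩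
    have hpq : 0 < (q₁ ^ 2 + q₁ * q₂ + k * q₂ ^ 2) + (p₁ ^ 2 + p₁ * p₂ + k * p₂ ^ 2) := by
      by_contra hneg
      obtain ⟨rfl, rfl⟩ := zeroN q₁ q₂ (by linarith [posN p₁ p₂, posN q₁ q₂])
      obtain ⟨rfl, rfl⟩ := zeroN p₁ p₂ (by linarith [posN p₁ p₂, posN 0 0])
      simp at hre
    have key := lorentz_neg (b := 1) (k := k) (δ := 4 * k - 1) (by linarith) (by linarith)
      (a := q₁ ^ 2 + q₁ * q₂ + k * q₂ ^ 2) (c := p₁ ^ 2 + p₁ * p₂ + k * p₂ ^ 2)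
      (m := p₁ * (q₁ + q₂) + k * p₂ * q₂ + (1 - 2 * k) * (p₂ * q₁ - p₁ * q₂))
      (n := -(2 * (p₁ * (q₁ + q₂) + k * p₂ * q₂) + (p₂ * q₁ - p₁ * q₂)))
      (posN _ _) (posN _ _) hpq (le_of_eq (by ring))
      (a' := a) (c' := c) (m' := m) (n' := n) (by linarith) (by linarith)
    have h1 : 0 < (4 * k - 1) * (a * (p₁ ^ 2 + p₁ * p₂ + k * p₂ ^ 2)
        + c * (q₁ ^ 2 + q₁ * q₂ + k * q₂ ^ 2)
        - (p₁ * m - k * p₂ * n) * q₂ + (p₁ * n + p₂ * m + p₂ * n) * q₁) := by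
      linarith
    have h2 := pos_of_mul_pos_right h1 (by linarith)
    simp
    linarith
  · intro M hM
    obtain ⟨a, c, m, n, rfl⟩ := exists_oddSkew hM
    obtain ⟨⟨p₁, p₂⟩, ⟨q₁, q₂⟩, ⟨r₁, r₂⟩, ⟨s₁, s₂⟩, h, rfl⟩ := SL2.exists_ofEntries s
    have hre := congrArg QuadraticAlgebra.re h
    have him := congrArg QuadraticAlgebra.im h
    simp [QuadraticAlgebra.re_one, QuadraticAlgebra.im_one] at hre him
    rw [oddTrace_oddSkew, oddSkew, congrAct_ofEntries, oddTrace]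
    simp
    refine ⟨a * (p₁ * r₂ - p₂ * r₁) + c * (q₁ * s₂ - q₂ * s₁)
      + s₂ * (p₁ * n + p₂ * m + p₂ * n) - (m * r₂ + n * r₁ + n * r₂) * q₂, ?_⟩
    linear_combination (2 * m + n) * hre + (m + n - 2 * k * n) * him

end OddDiscriminant

section OddWalls

open Matrix

variable {k : ℤ}

theorem oddForm_sub_left (M N N' : OddMat k) :
    oddForm (M - N) N' = oddForm M N' - oddForm N N' := by
  rw [oddForm_comm, oddForm_sub, oddForm_comm N', oddForm_comm N']

theorem oddForm_add_left (M N N' : OddMat k) :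
    oddForm (M + N) N' = oddForm M N' + oddForm N N' := by
  rw [oddForm_comm, oddForm_add, oddForm_comm N', oddForm_comm N']

theorem oddForm_smul_left (c : ℤ) (M N : OddMat k) : oddForm (c • M) N = c * oddForm M N := by
  rw [oddForm_comm, oddForm_smul, oddForm_comm]

theorem oddForm_neg_left (M N : OddMat k) : oddForm (-M) N = -oddForm M N := by
  rw [oddForm_comm, oddForm_neg, oddForm_comm]

theorem oddTrace_sub (M N : OddMat k) : oddTrace (M - N) = oddTrace M - oddTrace N := by
  simp [oddTrace]; ring

theorem oddTrace_neg (M : OddMat k) : oddTrace (-M) = -oddTrace M := by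
  simp [oddTrace]; ring

theorem oddTrace_smul (c : ℤ) (M : OddMat k) : oddTrace (c • M) = c * oddTrace M := by
  simp [oddTrace]; ring

theorem conjTranspose_neg_smul {M : OddMat k} (hM : Mᴴ = -M) (c : ℤ) : (c • M)ᴴ = -(c • M) := by
  rw [conjTranspose_smul, hM, star_trivial, smul_neg]

theorem dvd_of_dvd_two_mul {x : ℤ} (h : 4 * k - 1 ∣ 2 * x) : 4 * k - 1 ∣ x := by
  have := dvd_sub (h.mul_left (2 * k)) (dvd_mul_right (4 * k - 1) x)
  rwa [show 2 * k * (2 * x) - (4 * k - 1) * x = x by ring] at this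

/-- The skew-Hermitian matrices of determinant `1` whose reflection preserves the lattice
up to sign modulo the discriminant. -/
def OddRoot (h : OddMat k) : Prop :=
  hᴴ = -h ∧ oddForm h h = 2 ∧ (4 * k - 1 ∣ oddTrace h - 2 ∨ 4 * k - 1 ∣ oddTrace h + 2)

/-- The trace condition satisfied by base points and by the walls that cut the chamber. -/
def OddUnitTrace (x : OddMat k) : Prop :=
  4 * k - 1 ∣ oddTrace x - 1 ∨ 4 * k - 1 ∣ oddTrace x + 1

theorem OddIsometry.oddFuture {g : OddMat k ≃ₗ[ℤ] OddMat k} (hg : OddIsometry g) {x : OddMat k}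
    (hx : OddFuture x) : OddFuture (g x) :=
  ⟨hg.skew _ hx.1, (hg.form x x).trans_lt hx.2.1, hg.future x hx⟩

theorem OddIsometry.oddUnitTrace {g : OddMat k ≃ₗ[ℤ] OddMat k} (hg : OddIsometry g)
    {x : OddMat k} (hs : xᴴ = -x) (hx : OddUnitTrace x) : OddUnitTrace (g x) := by
  obtain ⟨ε, hε, h⟩ := hg.trace
  have h' := h x hs
  rcases hε with rfl | rfl <;> rcases hx with hx | hx
  · left; simpa using dvd_add h' hx
  · right
    have := dvd_add h' hx
    rwa [show oddTrace (g x) - 1 * oddTrace x + (oddTrace x + 1) = oddTrace (g x) + 1 by ring]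
      at this
  · right
    have := dvd_sub h' hx
    rwa [show oddTrace (g x) - -1 * oddTrace x - (oddTrace x - 1) = oddTrace (g x) + 1 by ring]
      at this
  · left
    have := dvd_sub h' hx
    rwa [show oddTrace (g x) - -1 * oddTrace x - (oddTrace x + 1) = oddTrace (g x) - 1 by ring]
      at this

theorem OddIsometry.oddRoot {g : OddMat k ≃ₗ[ℤ] OddMat k} (hg : OddIsometry g)
    {x : OddMat k} (hx : OddRoot x) : OddRoot (g x) := by
  obtain ⟨ε, hε, h⟩ := hg.trace
  obtain ⟨hs, hq, hx⟩ := hx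
  refine ⟨hg.skew _ hs, (hg.form x x).trans hq, ?_⟩
  have h' := h x hs
  rcases hε with rfl | rfl <;> rcases hx with hx | hx
  · left; simpa using dvd_add h' hx
  · right
    have := dvd_add h' hx
    rwa [show oddTrace (g x) - 1 * oddTrace x + (oddTrace x + 2) = oddTrace (g x) + 2 by ring]
      at this
  · right
    have := dvd_sub h' hx
    rwa [show oddTrace (g x) - -1 * oddTrace x - (oddTrace x - 2) = oddTrace (g x) + 2 by ring]
      at this
  · left
    have := dvd_sub h' hx
    rwa [show oddTrace (g x) - -1 * oddTrace x - (oddTrace x + 2) = oddTrace (g x) - 2 by ring]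
      at this

theorem OddRoot.neg {h : OddMat k} (hh : OddRoot h) : OddRoot (-h) := by
  obtain ⟨h1, h2, h3⟩ := hh
  refine ⟨by rw [conjTranspose_neg, h1], by rw [oddForm_neg_left, oddForm_neg, h2]; rfl, ?_⟩
  rw [oddTrace_neg]
  rcases h3 with h3 | h3
  · right; rw [← dvd_neg]; simpa [sub_eq_neg_add, add_comm] using h3
  · left; rw [← dvd_neg]; simpa [sub_eq_neg_add, add_comm] using h3

/-- The reflection in a root. -/
theorem OddRoot.exists_reflection (hk : 2 ≤ k) {h : OddMat k} (hh : OddRoot h) :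
    ∃ r : oddIsometryGroup k, ∀ M, r.1 M = M - oddForm h M • h := by
  obtain ⟨h1, h2, h3⟩ := hh
  let φ : OddMat k →ₗ[ℤ] OddMat k :=
    { toFun := fun M => M - oddForm h M • h
      map_add' := fun M N => by rw [oddForm_add, add_smul]; abel
      map_smul' := fun c M => by
        rw [oddForm_smul, mul_smul, RingHom.id_apply, smul_sub] }
  have hφ : ∀ M, φ M = M - oddForm h M • h := fun _ => rfl
  have hinv : Function.Involutive φ := fun M => by
    rw [hφ, hφ, oddForm_sub, oddForm_smul, h2, sub_sub, ← add_smul,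
      show oddForm h M + (oddForm h M - oddForm h M * 2) = 0 by ring, zero_smul, sub_zero]
  let r := LinearEquiv.ofInvolutive φ hinv
  have hr : ∀ M, r M = M - oddForm h M • h := hφ
  have hform : ∀ M N, oddForm (r M) (r N) = oddForm M N := fun M N => by
    rw [hr, hr, oddForm_sub, oddForm_smul, oddForm_sub_left, oddForm_sub_left, oddForm_smul_left,
      oddForm_smul_left, h2, oddForm_comm M h]
    ring
  have hskew : ∀ M, Mᴴ = -M → (r M)ᴴ = -r M := fun M hM => by
    rw [hr, conjTranspose_sub, conjTranspose_neg_smul h1, hM]; abel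
  have hiso : OddIsometry r := by
    refine ⟨hform, hskew, fun M hM => ?_, -1, Or.inr rfl, fun M hM => ?_⟩
    · have hlt : oddForm (r M) M < 0 := by
        rw [hr, oddForm_sub_left, oddForm_smul_left]
        nlinarith [hM.2.1, mul_self_nonneg (oddForm h M)]
      by_contra hneg
      have hq : oddForm (r M) (r M) < 0 := (hform M M).trans_lt hM.2.1
      have hs := hskew M hM.1
      have hne : (r M 0 0).re ≠ 0 := by
        intro h0
        obtain ⟨a, c, m, n, e⟩ := exists_oddSkew hs
        rw [e, oddSkew_zero_zero] at h0
        rw [e, oddForm_oddSkew, neg_eq_zero.1 h0] at hq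
        nlinarith [sq_nonneg (2 * m + n), sq_nonneg n]
      have hfut : OddFuture (-r M) := by
        refine ⟨by rw [conjTranspose_neg, hs], by rwa [oddForm_neg_left, oddForm_neg, neg_neg], ?_⟩
        rw [Matrix.neg_apply, QuadraticAlgebra.re_neg]
        omega
      have := oddForm_neg_of_future hk hfut hM
      rw [oddForm_neg_left] at this
      omega
    · obtain ⟨v, hv⟩ := two_mul_oddForm h1 hM
      have h4 : 4 * k - 1 ∣ (oddTrace h - 2) * (oddTrace h + 2) := by
        rcases h3 with h3 | h3
        · exact h3.mul_right _
        · exact h3.mul_left _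
      obtain ⟨w, hw⟩ := h4
      apply dvd_of_dvd_two_mul
      rw [hr, oddTrace_sub, oddTrace_smul]
      exact ⟨-(v * oddTrace h) - oddTrace M * w, by
        linear_combination (-oddTrace h) * hv - oddTrace M * hw⟩
  have hrinv : r⁻¹ = r := by
    rw [inv_eq_iff_mul_eq_one]
    ext1 M
    exact hinv M
  exact ⟨⟨r, hiso, by rwa [hrinv]⟩, hr⟩

/-- Two vectors of the same norm whose span is not positive definite are nested as walls. -/
theorem odd_nested (hk : 2 ≤ k) {v v' : OddMat k} (hv : vᴴ = -v) (hv' : v'ᴴ = -v')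
    (hq : oddForm v v = oddForm v' v')
    (hF : oddForm v v ≤ oddForm v v' ∨ oddForm v v' ≤ -oddForm v v) :
    v' = v ∨ v' = -v ∨
      (∀ x, OddFuture x → oddForm v x < oddForm v' x) ∨
      (∀ x, OddFuture x → oddForm v' x < oddForm v x) ∨
      (∀ x, OddFuture x → 0 < oddForm v x + oddForm v' x) ∨
      (∀ x, OddFuture x → oddForm v x + oddForm v' x < 0) := by
  rcases hF with hF | hF
  · by_cases heq : v' - v = 0
    · exact Or.inl (sub_eq_zero.1 heq)
    have hsk : (v' - v)ᴴ = -(v' - v) := by rw [conjTranspose_sub, hv, hv']; abel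
    have hc := oddForm_sign_of_causal hk hsk heq (by
      rw [oddForm_sub, oddForm_sub_left, oddForm_sub_left, oddForm_comm v' v]; linarith)
    rcases hc with hc | hc
    · refine Or.inr (Or.inr (Or.inr (Or.inl fun x hx => ?_)))
      have := hc x hx
      rw [oddForm_sub_left] at this
      linarith
    · refine Or.inr (Or.inr (Or.inl fun x hx => ?_))
      have := hc x hx
      rw [oddForm_sub_left] at this
      linarith
  · by_cases heq : v' + v = 0
    · exact Or.inr (Or.inl (eq_neg_of_add_eq_zero_left heq))
    have hsk : (v' + v)ᴴ = -(v' + v) := by rw [conjTranspose_add, hv, hv']; abel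
    have hc := oddForm_sign_of_causal hk hsk heq (by
      rw [oddForm_add, oddForm_add_left, oddForm_add_left, oddForm_comm v' v]; linarith)
    rcases hc with hc | hc
    · refine Or.inr (Or.inr (Or.inr (Or.inr (Or.inr fun x hx => ?_))))
      have := hc x hx
      rw [oddForm_add_left] at this
      linarith
    · refine Or.inr (Or.inr (Or.inr (Or.inr (Or.inl fun x hx => ?_))))
      have := hc x hx
      rw [oddForm_add_left] at this
      linarith

/-- The base point. -/
def oddBase (k : ℤ) : OddMat k := oddSkew k 1 1 0 1

theorem oddFuture_oddBase (hk : 2 ≤ k) : OddFuture (oddBase k) := by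
  refine ⟨oddSkew_conjTranspose _ _ _ _, ?_, ?_⟩
  · rw [oddBase, oddForm_oddSkew]; linarith
  · rw [oddBase, oddSkew_zero_zero]; norm_num

theorem oddUnitTrace_oddBase : OddUnitTrace (oddBase k) := by
  left; rw [oddBase, oddTrace_oddSkew]; simp

/-- A product of residues `±s` and `±t` is a residue `±st`. -/
theorem dvd_mul_sub_or_add {δ x y s t : ℤ} (hx : δ ∣ x - s ∨ δ ∣ x + s)
    (hy : δ ∣ y - t ∨ δ ∣ y + t) : δ ∣ x * y - s * t ∨ δ ∣ x * y + s * t := by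
  rcases hx with ⟨u, hu⟩ | ⟨u, hu⟩ <;> rcases hy with ⟨w, hw⟩ | ⟨w, hw⟩
  · exact Or.inl ⟨u * y + s * w, by linear_combination y * hu + s * hw⟩
  · exact Or.inr ⟨u * y + s * w, by linear_combination y * hu + s * hw⟩
  · exact Or.inr ⟨u * y - s * w, by linear_combination y * hu - s * hw⟩
  · exact Or.inl ⟨u * y - s * w, by linear_combination y * hu - s * hw⟩

theorem two_mul_oddForm_sub_or_add {M N : OddMat k} (hM : Mᴴ = -M) (hN : Nᴴ = -N) {s t : ℤ}
    (hs : 4 * k - 1 ∣ oddTrace M - s ∨ 4 * k - 1 ∣ oddTrace M + s)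
    (ht : 4 * k - 1 ∣ oddTrace N - t ∨ 4 * k - 1 ∣ oddTrace N + t) :
    4 * k - 1 ∣ 2 * oddForm M N - s * t ∨ 4 * k - 1 ∣ 2 * oddForm M N + s * t := by
  have h := two_mul_oddForm hM hN
  rcases dvd_mul_sub_or_add hs ht with h' | h'
  · left; simpa using dvd_add h h'
  · right
    have := dvd_add h h'
    rwa [show 2 * oddForm M N - oddTrace M * oddTrace N + (oddTrace M * oddTrace N + s * t)
      = 2 * oddForm M N + s * t by ring] at this

theorem OddRoot.oddForm_ne_zero (hk : 2 ≤ k) {h x : OddMat k} (hh : OddRoot h) (hx : OddFuture x)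
    (hx' : OddUnitTrace x) : oddForm h x ≠ 0 := by
  intro h0
  have := two_mul_oddForm_sub_or_add hh.1 hx.1 hh.2.2 hx'
  rw [h0] at this
  rcases this with h | h
  · have := Int.le_of_dvd (by norm_num) (dvd_neg.2 h)
    omega
  · have := Int.le_of_dvd (by norm_num) h
    omega

theorem OddRoot.le_oddForm (hk : 2 ≤ k) {h h' : OddMat k} (hh : OddRoot h) (hh' : OddRoot h') :
    2 ≤ oddForm h h' ∨ oddForm h h' ≤ -2 := by
  by_contra hneg
  have key : oddForm h h' = -1 ∨ oddForm h h' = 0 ∨ oddForm h h' = 1 := by omega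
  have hd := two_mul_oddForm_sub_or_add hh.1 hh'.1 hh.2.2 hh'.2.2
  have h7 : 7 ≤ 4 * k - 1 := by omega
  generalize 4 * k - 1 = δ at hd h7
  rcases hd with ⟨u, hu⟩ | ⟨u, hu⟩ <;> rcases key with e | e | e <;> rw [e] at hu
  all_goals
    have : u = 0 ∨ 1 ≤ u ∨ u ≤ -1 := by omega
    rcases this with rfl | h | h
    · omega
    · nlinarith
    · nlinarith

end OddWalls

section OddSplitting

open Matrix

variable {k : ℤ}

/-- The walls orthogonal to the roots. -/
def oddRootWalls (hk : 2 ≤ k) : WallSystem (oddIsometryGroup k) (OddMat k) where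
  act := (oddIsometryGroup k).subtype
  side := fun v g => oddForm v (g.1 (oddBase k))
  walls := {h | OddRoot h}
  side_act := fun h v g => h.2.1.form _ _
  side_neg := fun v g => oddForm_neg_left _ _
  act_mem := fun g v hv => g.2.1.oddRoot hv
  neg_mem := fun v hv => OddRoot.neg hv
  side_ne_zero := fun v hv g => OddRoot.oddForm_ne_zero hk hv
    (g.2.1.oddFuture (oddFuture_oddBase hk))
    (g.2.1.oddUnitTrace (oddSkew_conjTranspose _ _ _ _) oddUnitTrace_oddBase)
  nested := fun v hv v' hv' => by
    have hfut : ∀ g : oddIsometryGroup k, OddFuture (g.1 (oddBase k)) := fun g =>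
      g.2.1.oddFuture (oddFuture_oddBase hk)
    have hn := odd_nested hk hv.1 hv'.1 (hv.2.1.trans hv'.2.1.symm)
      (by rw [hv.2.1]; exact OddRoot.le_oddForm hk hv hv')
    rcases hn with h | h | h | h | h | h
    · exact Or.inl h
    · exact Or.inr (Or.inl h)
    · exact Or.inr (Or.inr (Or.inl fun g => h _ (hfut g)))
    · exact Or.inr (Or.inr (Or.inr (Or.inl fun g => h _ (hfut g))))
    · exact Or.inr (Or.inr (Or.inr (Or.inr (Or.inl fun g => h _ (hfut g)))))
    · exact Or.inr (Or.inr (Or.inr (Or.inr (Or.inr fun g => h _ (hfut g)))))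

/-- The sign of a root on points near the cusp is determined by the root alone. -/
theorem OddRoot.oddForm_neg_iff (hk : 2 ≤ k) {a c m n A C m' n' : ℤ}
    (hh : OddRoot (oddSkew k a c m n)) (hA : 0 < A) (hC : 0 < C)
    (hq : 4 * k * (m' ^ 2 + m' * n' + k * n' ^ 2) < (4 * k - 1) ^ 2 * (A * C))
    (hpos : 0 < 2 * m' + n') (hltA : 2 * m' + n' < (4 * k - 1) * A)
    (hltC : 2 * m' + n' < (4 * k - 1) * C) :
    oddForm (oddSkew k a c m n) (oddSkew k A C m' n') < 0 ↔
      0 < c ∨ (c = 0 ∧ 0 < a) ∨ (c = 0 ∧ a = 0 ∧ m < 0) := by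
  have hN := hh.2.1
  rw [oddForm_oddSkew] at hN ⊢
  have hN' : m ^ 2 + m * n + k * n ^ 2 = 1 + (4 * k - 1) * (a * c) := by linarith
  have posN : ∀ x y : ℤ, 0 ≤ x ^ 2 + x * y + k * y ^ 2 := fun x y => by
    nlinarith [sq_nonneg (2 * x + y), sq_nonneg y]
  have hac : 0 ≤ a * c := by
    by_contra hneg
    nlinarith [posN m n]
  have hδ : 0 < 4 * k - 1 := by omega
  rcases hac.eq_or_lt with h0 | h0
  · rw [← h0, mul_zero, add_zero] at hN'
    have hn : n = 0 := by
      by_contra hn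
      have : 0 < n ^ 2 := by positivity
      nlinarith [sq_nonneg (2 * m + n)]
    subst hn
    have hm : m = 1 ∨ m = -1 := mul_self_eq_one_iff.1 (by linarith)
    have hmτ : |m * (2 * m' + n')| = 2 * m' + n' := by
      rcases hm with rfl | rfl
      · rw [one_mul, abs_of_pos hpos]
      · rw [neg_one_mul, abs_neg, abs_of_pos hpos]
    have h1 := le_abs_self (m * (2 * m' + n'))
    have h2 := neg_abs_le (m * (2 * m' + n'))
    rw [hmτ] at h1 h2
    have large : ∀ x y : ℤ, 0 < x → 2 * m' + n' < (4 * k - 1) * y →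
        2 * m' + n' < (4 * k - 1) * (x * y) := fun x y hx hy => by
      have : 0 < (4 * k - 1) * y := hpos.trans hy
      nlinarith
    rcases mul_eq_zero.1 h0.symm with rfl | rfl
    · rcases lt_trichotomy c 0 with hc | rfl | hc
      · have := large (-c) A (by omega) hltA
        constructor
        · intro h; linarith
        · intro h; omega
      · rcases hm with rfl | rfl <;> simp <;> linarith
      · have := large c A hc hltA
        exact ⟨fun _ => Or.inl hc, fun _ => by linarith⟩
    · rcases lt_trichotomy a 0 with ha | rfl | ha
      · have := large (-a) C (by omega) hltC
        constructor
        · intro h; linarith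
        · intro h; omega
      · rcases hm with rfl | rfl <;> simp <;> linarith
      · have := large a C ha hltC
        exact ⟨fun _ => Or.inr (Or.inl ⟨rfl, ha⟩), fun _ => by linarith⟩
  · have hcs : (2 * m * m' + 1 * (m * n' + m' * n) + 2 * k * n * n') ^ 2
        ≤ 4 * (m ^ 2 + m * n + k * n ^ 2) * (m' ^ 2 + m' * n' + k * n' ^ 2) := by
      have := mul_nonneg hδ.le (sq_nonneg (m * n' - m' * n))
      linarith
    have hlt : 4 * (m ^ 2 + m * n + k * n ^ 2) * (m' ^ 2 + m' * n' + k * n' ^ 2)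
        < ((4 * k - 1) * (a * C + A * c)) ^ 2 := by
      have h1 : m ^ 2 + m * n + k * n ^ 2 ≤ 4 * k * (a * c) := by linarith
      have h2 := mul_le_mul_of_nonneg_right h1 (posN m' n')
      have h3 := mul_lt_mul_of_pos_left hq h0
      have h4 := mul_nonneg (sq_nonneg (4 * k - 1)) (sq_nonneg (a * C - A * c))
      linarith
    have habs := sq_lt_sq.1 (hcs.trans_lt hlt)
    rcases pos_and_pos_or_neg_and_neg_of_mul_pos h0 with ⟨ha, hc⟩ | ⟨ha, hc⟩
    · have hp : 0 < (4 * k - 1) * (a * C + A * c) := by positivity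
      rw [abs_of_pos hp] at habs
      have := (abs_lt.1 habs).2
      exact ⟨fun _ => Or.inl hc, fun _ => by linarith⟩
    · have hp : (4 * k - 1) * (a * C + A * c) < 0 :=
        mul_neg_of_pos_of_neg hδ (add_neg (mul_neg_of_neg_of_pos ha hC)
          (mul_neg_of_pos_of_neg hA hc))
      rw [abs_of_neg hp] at habs
      have := (abs_lt.1 habs).1
      constructor
      · intro h; linarith
      · intro h; omega

theorem mem_chamber_oddRootWalls (hk : 2 ≤ k) {g : oddIsometryGroup k} {A C m' n' : ℤ}
    (hg : g.1 (oddBase k) = oddSkew k A C m' n') (hA : 0 < A) (hC : 0 < C)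
    (hq : 4 * k * (m' ^ 2 + m' * n' + k * n' ^ 2) < (4 * k - 1) ^ 2 * (A * C))
    (hpos : 0 < 2 * m' + n') (hltA : 2 * m' + n' < (4 * k - 1) * A)
    (hltC : 2 * m' + n' < (4 * k - 1) * C) : g ∈ (oddRootWalls hk).chamber := by
  rw [WallSystem.mem_chamber]
  intro U hU
  change oddForm U (g.1 (oddBase k)) < 0 ↔ oddForm U (oddBase k) < 0
  obtain ⟨a, c, m, n, rfl⟩ := exists_oddSkew hU.1
  rw [hg, OddRoot.oddForm_neg_iff hk hU hA hC hq hpos hltA hltC, oddBase,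
    OddRoot.oddForm_neg_iff hk hU one_pos one_pos (by nlinarith) (by norm_num) (by linarith)
      (by linarith)]

/-- The base wall of the splitting. -/
def oddWall (k : ℤ) : OddMat k := oddSkew k 0 0 1 (-1)

theorem exists_odd_fold (hk : 2 ≤ k) : ∃ π : oddIsometryGroup k →* oddIsometryGroup k,
    (∀ g, ∀ h, OddRoot h →
      (oddForm h ((π g).1 (oddBase k)) < 0 ↔ oddForm h (oddBase k) < 0)) ∧
    (∃ s, ∀ γ, γ.1 = congrAct s → (π γ).1 (oddWall k) = -oddWall k) ∧
    (∃ s, ∀ γ, γ.1 = congrAct s → (π γ).1 (oddWall k) = oddSkew k 0 0 0 1) := by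
  have hex : ∀ h : OddMat k, ∃ r : oddIsometryGroup k,
      OddRoot h → ∀ M, r.1 M = M - oddForm h M • h := fun h => by
    by_cases hh : OddRoot h
    · obtain ⟨r, hr⟩ := hh.exists_reflection hk
      exact ⟨r, fun _ => hr⟩
    · exact ⟨1, fun h' => absurd h' hh⟩
  choose s hs using hex
  have hext : ∀ g g' : oddIsometryGroup k, (∀ M, g.1 M = g'.1 M) → g = g' := fun g g' h =>
    Subtype.ext (LinearEquiv.ext h)
  have hss : ∀ h, OddRoot h → s h * s h = 1 := fun h hh => hext _ _ fun M => by
    change (s h).1 ((s h).1 M) = M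
    rw [hs h hh, hs h hh, oddForm_sub, oddForm_smul, hh.2.1, sub_sub, ← add_smul,
      show oddForm h M + (oddForm h M - oddForm h M * 2) = 0 by ring, zero_smul, sub_zero]
  obtain ⟨π, hπ, hfix, hfold⟩ := (oddRootWalls hk).exists_fold s hss
    (fun h hh => by
      change (s h).1 h = -h
      rw [hs h hh, hh.2.1, two_smul]; abel)
    (fun h hh g => by
      rw [mul_inv_eq_iff_eq_mul]
      refine hext _ _ fun M => ?_
      change g.1 ((s h).1 M) = (s (g.1 h)).1 (g.1 M)
      rw [hs h hh, hs (g.1 h) (g.2.1.oddRoot hh), g.2.1.form, map_sub, map_smul])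
    (fun g => (oddForm (g.1 (oddBase k)) (oddBase k)).natAbs)
    (fun h hh h1 g hg => by
      change oddForm h (oddBase k) < 0 at h1
      change 0 < oddForm h (g.1 (oddBase k)) at hg
      change (oddForm ((s h).1 (g.1 (oddBase k))) (oddBase k)).natAbs < _
      have hb := oddFuture_oddBase hk
      have e1 := oddForm_neg_of_future hk (g.2.1.oddFuture hb) hb
      have e2 := oddForm_neg_of_future hk ((s h).2.1.oddFuture (g.2.1.oddFuture hb)) hb
      have e3 := mul_neg_of_pos_of_neg hg h1
      rw [hs h hh, oddForm_sub_left, oddForm_smul_left] at e2 ⊢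
      omega)
  have hP : OddRoot (oddSkew k 0 0 (-1) 0) := by
    refine ⟨oddSkew_conjTranspose _ _ _ _, by rw [oddForm_oddSkew]; ring, Or.inr ?_⟩
    rw [oddTrace_oddSkew]; simp
  have hPsimple : (oddRootWalls hk).Simple (oddSkew k 0 0 (-1) 0) 1 := by
    have hside : (oddRootWalls hk).side (oddSkew k 0 0 (-1) 0) 1 = -1 := by
      change oddForm _ (oddSkew k 1 1 0 1) = -1
      rw [oddForm_oddSkew]; ring
    refine ⟨hP, by rw [hside]; norm_num, fun U hU hneg hall => ?_⟩
    have := hall 1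
    omega
  have hreflect : ∀ a c m n, (s (oddSkew k 0 0 (-1) 0)).1 (oddSkew k a c m n)
      = oddSkew k a c (-m - n) n := fun a c m n => by
    rw [hs _ hP, oddForm_oddSkew]
    ext i j <;> fin_cases i <;> fin_cases j <;> simp [oddSkew] <;> ring
  refine ⟨π, fun g h hh => hπ g h hh, ⟨SL2.ofEntries 0 (-1) 1 ⟨0, -1⟩ (by simp), fun γ hγ => ?_⟩,
    ⟨SL2.ofEntries 0 (-1) 1 0 (by simp), fun γ hγ => ?_⟩⟩
  · have hss' := hss _ hP
    have e : γ = γ * s (oddSkew k 0 0 (-1) 0) * s (oddSkew k 0 0 (-1) 0) := by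
      rw [mul_assoc, hss', mul_one]
    have hact : ∀ a c m n, (γ * s (oddSkew k 0 0 (-1) 0)).1 (oddSkew k a c m n)
        = congrAct (SL2.ofEntries 0 (-1) 1 ⟨0, -1⟩ (by simp)) (oddSkew k a c (-m - n) n) :=
      fun a c m n => by
        rw [← hγ, ← hreflect]; rfl
    have hmem : γ * s (oddSkew k 0 0 (-1) 0) ∈ (oddRootWalls hk).chamber := by
      apply mem_chamber_oddRootWalls hk (A := 1) (C := k) (m' := 2 * k - 1) (n' := 0) ?_
        one_pos (by omega) (by nlinarith) (by linarith) (by linarith) (by nlinarith)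
      rw [oddBase, hact, oddSkew, congrAct_ofEntries, oddSkew]
      ext i j <;> fin_cases i <;> fin_cases j <;> simp <;> ring
    rw [e, hfold _ hmem _ hPsimple, oddWall, hact, oddSkew, congrAct_ofEntries, oddSkew]
    ext i j <;> fin_cases i <;> fin_cases j <;> simp
  · have hmem : γ ∈ (oddRootWalls hk).chamber := by
      apply mem_chamber_oddRootWalls hk (A := 1) (C := 1) (m' := 1) (n' := -1) ?_
        one_pos one_pos (by nlinarith) (by norm_num) (by linarith) (by linarith)
      rw [hγ, oddBase, oddSkew, congrAct_ofEntries, oddSkew]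
      ext i j <;> fin_cases i <;> fin_cases j <;> simp
    rw [hfix _ hmem, hγ, oddWall, oddSkew, congrAct_ofEntries, oddSkew]
    ext i j <;> fin_cases i <;> fin_cases j <;> simp

end OddSplitting

section OddAmalgam

open Matrix

variable {k : ℤ}

theorem OddUnitTrace.sub_or_add {v v' : OddMat k} (hv : OddUnitTrace v)
    (h : 4 * k - 1 ∣ oddTrace v * oddTrace v' + 1) :
    4 * k - 1 ∣ oddTrace (v' - v) - 2 ∨ 4 * k - 1 ∣ oddTrace (v' - v) + 2 := by
  obtain ⟨w, hw⟩ := h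
  rw [oddTrace_sub]
  rcases hv with ⟨u, hu⟩ | ⟨u, hu⟩
  · exact Or.inr ⟨w - u - u * oddTrace v', by linear_combination hw - (1 + oddTrace v') * hu⟩
  · exact Or.inl ⟨-w - u + u * oddTrace v', by linear_combination -hw + (oddTrace v' - 1) * hu⟩

/-- A group acting on `2 × 2` matrices over `ℤ[ω]`, `ω² = ω - k`, through the transformations
`M ↦ g M gᴴ`, and through all of them, is an amalgam. -/
theorem exists_amalgam_of_odd (hk : 2 ≤ k) {G : Type} [Group G]
    (α : G →* (Matrix (Fin 2) (Fin 2) (QuadraticAlgebra ℤ (-k) 1) ≃ₗ[ℤ]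
      Matrix (Fin 2) (Fin 2) (QuadraticAlgebra ℤ (-k) 1)))
    (hα : ∀ g, ∃ s, α g = congrAct s) (hα' : ∀ s, ∃ g, α g = congrAct s) :
    ∃ (A B C : GrpCat) (f : C →* A) (g : C →* B),
      Function.Injective f ∧ ¬ Function.Surjective f ∧
      Function.Injective g ∧ ¬ Function.Surjective g ∧
      Nonempty (G ≃* AmalgamatedFreeProduct f g) := by
  obtain ⟨π, hπ, ⟨s₁, hs₁⟩, ⟨s₂, hs₂⟩⟩ := exists_odd_fold hk
  let β : G →* oddIsometryGroup k := π.comp (α.codRestrict _ fun g => by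
    obtain ⟨s, hs⟩ := hα g
    rw [hs]
    exact congrAct_mem_oddIsometryGroup hk s)
  have hroot : ∀ g h, OddRoot h →
      (oddForm h ((β g).1 (oddBase k)) < 0 ↔ oddForm h (oddBase k) < 0) := fun g => hπ _
  obtain ⟨j, hj⟩ := hα' s₁
  obtain ⟨t, ht⟩ := hα' s₂
  have hjv : (β j).1 (oddWall k) = -oddWall k := hs₁ _ hj
  have htv : (β t).1 (oddWall k) = oddSkew k 0 0 0 1 := hs₂ _ ht
  have hmul : ∀ g h M, (β (g * h)).1 M = (β g).1 ((β h).1 M) := fun g h M => by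
    rw [map_mul]; rfl
  have hfut : ∀ g, OddFuture ((β g).1 (oddBase k)) := fun g =>
    (β g).2.1.oddFuture (oddFuture_oddBase hk)
  have hunit : ∀ g, OddUnitTrace ((β g).1 (oddBase k)) := fun g =>
    (β g).2.1.oddUnitTrace (oddSkew_conjTranspose _ _ _ _) oddUnitTrace_oddBase
  have hwskew : ∀ g, ((β g).1 (oddWall k))ᴴ = -(β g).1 (oddWall k) := fun g =>
    (β g).2.1.skew _ (oddSkew_conjTranspose _ _ _ _)
  have hwunit : ∀ g, OddUnitTrace ((β g).1 (oddWall k)) := fun g =>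
    (β g).2.1.oddUnitTrace (oddSkew_conjTranspose _ _ _ _)
      (Or.inl (by rw [oddWall, oddTrace_oddSkew]; simp))
  have hwnorm : ∀ g, oddForm ((β g).1 (oddWall k)) ((β g).1 (oddWall k)) = 2 * k := fun g => by
    rw [(β g).2.1.form, oddWall, oddForm_oddSkew]; ring
  have hconst : ∀ u, OddRoot u → (∀ g, 0 < oddForm u ((β g).1 (oddBase k))) ∨
      (∀ g, oddForm u ((β g).1 (oddBase k)) < 0) := by
    intro u hu
    by_cases h0 : oddForm u (oddBase k) < 0
    · exact Or.inr fun g => (hroot g u hu).2 h0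
    · refine Or.inl fun g => ?_
      have h1 := hu.oddForm_ne_zero hk (hfut g) (hunit g)
      have h2 := mt (hroot g u hu).1 h0
      omega
  let W : WallSystem G (OddMat k) :=
    { act := (oddIsometryGroup k).subtype.comp β
      side := fun v g => oddForm v ((β g).1 (oddBase k))
      walls := Set.range fun g => (β g).1 (oddWall k)
      side_act := fun h v g => by rw [hmul]; exact (β h).2.1.form _ _
      side_neg := fun v g => oddForm_neg_left _ _
      act_mem := by
        rintro g _ ⟨h, rfl⟩
        exact ⟨g * h, hmul _ _ _⟩
      neg_mem := by
        rintro _ ⟨h, rfl⟩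
        exact ⟨h * j, by simp only; rw [hmul, hjv, map_neg]⟩
      side_ne_zero := by
        rintro _ ⟨h, rfl⟩ g h0
        have hd := two_mul_oddForm_sub_or_add (hwskew h) (hfut g).1 (hwunit h) (hunit g)
        rw [h0] at hd
        rcases hd with hd | hd
        · have := Int.le_of_dvd (by norm_num) (dvd_neg.2 hd)
          omega
        · have := Int.le_of_dvd (by norm_num) hd
          omega
      nested := by
        rintro _ ⟨h, rfl⟩ _ ⟨h', rfl⟩
        have hsk := hwskew h
        have hsk' := hwskew h'
        have hun := hwunit h
        have hun' := hwunit h'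
        have hno := hwnorm h
        have hno' := hwnorm h'
        simp only
        generalize (β h).1 (oddWall k) = v at *
        generalize (β h').1 (oddWall k) = v' at *
        by_cases hF : oddForm v v ≤ oddForm v v' ∨ oddForm v v' ≤ -oddForm v v
        · rcases odd_nested hk hsk hsk' (hno.trans hno'.symm) hF with h | h | h | h | h | h
          · exact Or.inl h
          · exact Or.inr (Or.inl h)
          · exact Or.inr (Or.inr (Or.inl fun g => h _ (hfut g)))
          · exact Or.inr (Or.inr (Or.inr (Or.inl fun g => h _ (hfut g))))
          · exact Or.inr (Or.inr (Or.inr (Or.inr (Or.inl fun g => h _ (hfut g)))))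
          · exact Or.inr (Or.inr (Or.inr (Or.inr (Or.inr fun g => h _ (hfut g)))))
        have hval : oddForm v v' = 2 * k - 1 ∨ oddForm v v' = -(2 * k - 1) := by
          rw [hno] at hF
          rcases two_mul_oddForm_sub_or_add hsk hsk' hun hun' with ⟨u, hu⟩ | ⟨u, hu⟩
          · have : u = 0 ∨ 1 ≤ u ∨ u ≤ -1 := by omega
            rcases this with rfl | h | h
            · omega
            · have hle : (4 * k - 1) * 1 ≤ (4 * k - 1) * u := mul_le_mul_of_nonneg_left h (by omega)
              omega
            · have hle : (4 * k - 1) * u ≤ (4 * k - 1) * (-1) :=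
                mul_le_mul_of_nonneg_left h (by omega)
              omega
          · have : u = 0 ∨ 1 ≤ u ∨ u ≤ -1 := by omega
            rcases this with rfl | h | h
            · omega
            · have hle : (4 * k - 1) * 1 ≤ (4 * k - 1) * u := mul_le_mul_of_nonneg_left h (by omega)
              omega
            · have hle : (4 * k - 1) * u ≤ (4 * k - 1) * (-1) :=
                mul_le_mul_of_nonneg_left h (by omega)
              omega
        have hcong := two_mul_oddForm hsk hsk'
        rcases hval with hval | hval
        · have hu : OddRoot (v' - v) := by
            refine ⟨by rw [conjTranspose_sub, hsk, hsk']; abel, ?_, hun.sub_or_add ?_⟩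
            · rw [oddForm_sub, oddForm_sub_left, oddForm_sub_left, oddForm_comm v' v]
              linarith
            · obtain ⟨u, hu⟩ := hcong
              exact ⟨1 - u, by linear_combination 2 * hval - hu⟩
          rcases hconst _ hu with hc | hc
          · refine Or.inr (Or.inr (Or.inl fun g => ?_))
            have := hc g
            rw [oddForm_sub_left] at this
            linarith
          · refine Or.inr (Or.inr (Or.inr (Or.inl fun g => ?_)))
            have := hc g
            rw [oddForm_sub_left] at this
            linarith
        · have hu : OddRoot (v' + v) := by
            have hneg : OddUnitTrace (-v) := by
              rcases hun with ⟨u, hu⟩ | ⟨u, hu⟩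
              · exact Or.inr ⟨-u, by rw [oddTrace_neg]; linear_combination -hu⟩
              · exact Or.inl ⟨-u, by rw [oddTrace_neg]; linear_combination -hu⟩
            refine ⟨by rw [conjTranspose_add, hsk, hsk']; abel, ?_, ?_⟩
            · rw [oddForm_add, oddForm_add_left, oddForm_add_left, oddForm_comm v' v]
              linarith
            · rw [← sub_neg_eq_add]
              refine hneg.sub_or_add ?_
              obtain ⟨u, hu⟩ := hcong
              exact ⟨1 + u, by rw [oddTrace_neg]; linear_combination -2 * hval + hu⟩
          rcases hconst _ hu with hc | hc
          · refine Or.inr (Or.inr (Or.inr (Or.inr (Or.inl fun g => ?_))))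
            have := hc g
            rw [oddForm_add_left] at this
            linarith
          · refine Or.inr (Or.inr (Or.inr (Or.inr (Or.inr fun g => ?_))))
            have := hc g
            rw [oddForm_add_left] at this
            linarith }
  refine W.exists_amalgam (oddWall k) (fun v hv => hv) ⟨1, by simp⟩ j t hjv ?_ ?_
  · change (β t).1 _ ≠ _
    rw [htv]
    intro h
    have := congrArg QuadraticAlgebra.re (congrFun (congrFun h 0) 1)
    simp [oddWall, oddSkew] at this
  · change (β t).1 _ ≠ _
    rw [htv]
    intro h
    have := congrArg QuadraticAlgebra.re (congrFun (congrFun h 0) 1)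
    simp [oddWall, oddSkew] at this

end OddAmalgam

section RingOfIntegers

open Matrix

theorem sqrtNeg_mul_self (d : ℕ) :
    (Complex.I * (Real.sqrt d : ℂ)) * (Complex.I * (Real.sqrt d : ℂ)) = -d := by
  have h : ((Real.sqrt d : ℂ)) * (Real.sqrt d : ℂ) = d := by
    rw [← Complex.ofReal_mul, Real.mul_self_sqrt (Nat.cast_nonneg d), Complex.ofReal_natCast]
  linear_combination (Complex.I * Complex.I) * h + (d : ℂ) * Complex.I_mul_I

theorem isIntegral_of_mul_self {A : Type} [CommRing A] (a b : ℤ) {w : A}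
    (hw : w * w = a + b * w) : IsIntegral ℤ w := by
  refine ⟨Polynomial.X ^ 2 - Polynomial.C b * Polynomial.X - Polynomial.C a, by monicity!, ?_⟩
  rw [← Polynomial.aeval_def, map_sub, map_sub, map_mul, map_pow, Polynomial.aeval_X,
    Polynomial.aeval_C, Polynomial.aeval_C, algebraMap_int_eq, eq_intCast, eq_intCast]
  linear_combination hw

theorem exists_rat_of_mem_Qd {d : ℕ} {z : ℂ} (hz : z ∈ Qd d) :
    ∃ r s : ℚ, z = r + s * (Complex.I * (Real.sqrt d : ℂ)) := by
  have hx := sqrtNeg_mul_self d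
  have hz_int : IsIntegral ℤ (Complex.I * (Real.sqrt d : ℂ)) :=
    isIntegral_of_mul_self (-d) 0 (by rw [hx]; simp)
  have halg : IsAlgebraic ℚ (Complex.I * (Real.sqrt d : ℂ)) :=
    (hz_int.tower_top (A := ℚ)).isAlgebraic
  rw [Qd, ← IntermediateField.mem_toSubalgebra,
    IntermediateField.adjoin_simple_toSubalgebra_of_isAlgebraic halg] at hz
  induction hz using Algebra.adjoin_induction with
  | mem x hx => exact ⟨0, 1, by rw [Set.mem_singleton_iff.1 hx]; simp⟩
  | algebraMap r => exact ⟨r, 0, by simp⟩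
  | add x y _ _ ihx ihy =>
    obtain ⟨r, s, rfl⟩ := ihx
    obtain ⟨r', s', rfl⟩ := ihy
    exact ⟨r + r', s + s', by push_cast; ring⟩
  | mul x y _ _ ihx ihy =>
    obtain ⟨r, s, rfl⟩ := ihx
    obtain ⟨r', s', rfl⟩ := ihy
    exact ⟨r * r' - d * s * s', r * s' + s * r', by
      push_cast; linear_combination (s * s' : ℂ) * hx⟩

theorem exists_int_of_isIntegral {r : ℚ} (h : IsIntegral ℤ (r : ℂ)) : ∃ n : ℤ, r = n := by
  have h' : IsIntegral ℤ (algebraMap ℚ ℂ r) := h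
  rw [isIntegral_algebraMap_iff (algebraMap ℚ ℂ).injective, IsIntegrallyClosed.isIntegral_iff] at h'
  obtain ⟨n, hn⟩ := h'
  exact ⟨n, hn.symm⟩

theorem exists_int_of_mul_sq {d : ℕ} (hd : Squarefree d) {t : ℚ} {M : ℤ} (h : d * t ^ 2 = M) :
    ∃ q : ℤ, t = q := by
  have hden : (t.den : ℚ) ≠ 0 := by exact_mod_cast t.den_nz
  have h1 : (d : ℤ) * t.num ^ 2 = M * (t.den : ℤ) ^ 2 := by
    have h2 : (d : ℚ) * t.num ^ 2 = M * (t.den : ℚ) ^ 2 := by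
      rw [← h]
      nth_rewrite 2 [← Rat.num_div_den t]
      field_simp
    exact_mod_cast h2
  have hcop : IsCoprime ((t.den : ℤ) ^ 2) (t.num ^ 2) :=
    (Rat.isCoprime_num_den t).symm.pow
  have hdvd : (t.den : ℤ) ^ 2 ∣ d := hcop.dvd_of_dvd_mul_right ⟨M, by rw [h1]; ring⟩
  have hdvd' : t.den * t.den ∣ d := by
    rw [← sq]; exact_mod_cast hdvd
  have hone : t.den = 1 := Nat.isUnit_iff.1 (hd _ hdvd')
  exact ⟨t.num, by rw [← Rat.den_eq_one_iff t |>.1 hone]; simp⟩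

/-- An algebraic integer of `ℚ(√-d)` is `(p + q√-d) / 2` with `4 ∣ p² + dq²`. -/
theorem exists_int_of_mem_Qd {d : ℕ} (hd : Squarefree d) {z : ℂ} (hz : z ∈ Qd d)
    (hz_int : IsIntegral ℤ z) : ∃ p q n : ℤ, p ^ 2 + d * q ^ 2 = 4 * n ∧
      2 * z = p + q * (Complex.I * (Real.sqrt d : ℂ)) := by
  obtain ⟨r, s, rfl⟩ := exists_rat_of_mem_Qd hz
  have hx := sqrtNeg_mul_self d
  set x : ℂ := Complex.I * (Real.sqrt d : ℂ) with hxdef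
  have hconj : (starRingEnd ℂ) x = -x := by
    rw [hxdef, map_mul, Complex.conj_I, Complex.conj_ofReal, neg_mul]
  have hz_int' : IsIntegral ℤ ((r : ℂ) - s * x) := by
    have := hz_int.map (starRingEnd ℂ).toIntAlgHom
    have e : (starRingEnd ℂ).toIntAlgHom ((r : ℂ) + s * x) = r - s * x := by
      change (starRingEnd ℂ) ((r : ℂ) + s * x) = _
      rw [map_add, map_mul, hconj, map_ratCast, map_ratCast]; ring
    rwa [e] at this
  obtain ⟨p, hp⟩ := exists_int_of_isIntegral (r := 2 * r) (by
    have := hz_int.add hz_int'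
    rwa [show (r : ℂ) + s * x + (r - s * x) = ((2 * r : ℚ) : ℂ) by push_cast; ring] at this)
  obtain ⟨n, hn⟩ := exists_int_of_isIntegral (r := r ^ 2 + d * s ^ 2) (by
    have := hz_int.mul hz_int'
    rwa [show ((r : ℂ) + s * x) * (r - s * x) = ((r ^ 2 + d * s ^ 2 : ℚ) : ℂ) by
      push_cast; linear_combination (-(s : ℂ) ^ 2) * hx] at this)
  obtain ⟨q, hq⟩ := exists_int_of_mul_sq hd (t := 2 * s) (M := 4 * n - p ^ 2) (by
    push_cast; rw [← hn, ← hp]; ring)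
  refine ⟨p, q, n, ?_, ?_⟩
  · have : (p : ℚ) ^ 2 + d * (q : ℚ) ^ 2 = 4 * n := by rw [← hp, ← hq, ← hn]; ring
    exact_mod_cast this
  · have hp' : (2 * r : ℂ) = p := by exact_mod_cast congrArg (fun t : ℚ => (t : ℂ)) hp
    have hq' : (2 * s : ℂ) = q := by exact_mod_cast congrArg (fun t : ℚ => (t : ℂ)) hq
    rw [← hp', ← hq']; ring

/-- A description of `O_d` by a generator. -/
theorem nonempty_ringEquiv_Od {d : ℕ} {a b : ℤ} {w : ℂ} (hw : w ∈ Qd d)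
    (hww : w * w = a + b * w) (him : w.im ≠ 0)
    (hgen : ∀ z ∈ Qd d, IsIntegral ℤ z → ∃ x y : ℤ, z = x + y * w) :
    Nonempty (Od d ≃+* QuadraticAlgebra ℤ a b) := by
  have hval : Function.Injective (fun z : Od d => ((z : Qd d) : ℂ)) :=
    Subtype.val_injective.comp NumberField.RingOfIntegers.coe_injective
  have hwK : (⟨w, hw⟩ : Qd d) * ⟨w, hw⟩ = a + b * ⟨w, hw⟩ := Subtype.ext (by
    push_cast; exact hww)
  let θ : Od d := ⟨⟨w, hw⟩, isIntegral_of_mul_self a b hwK⟩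
  have hθ : θ * θ = a • 1 + b • θ := hval (by
    simp only [zsmul_eq_mul, mul_one]
    push_cast
    exact hww)
  let φ := QuadraticAlgebra.lift ⟨θ, hθ⟩
  have hφ : ∀ z, ((φ z : Qd d) : ℂ) = z.re + z.im * w := fun z => by
    change (((z.re • 1 + z.im • θ : Od d) : Qd d) : ℂ) = _
    simp only [zsmul_eq_mul, mul_one]
    push_cast
    rfl
  refine ⟨(RingEquiv.ofBijective φ ⟨?_, ?_⟩).symm⟩
  · rw [injective_iff_map_eq_zero]
    intro z hz
    have h := hφ z
    rw [hz] at h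
    have h1 := congrArg Complex.im h
    have h2 := congrArg Complex.re h
    simp at h1 h2
    have h3 : z.im = 0 := h1.resolve_right him
    rw [h3] at h2
    simp at h2
    exact QuadraticAlgebra.ext (by exact_mod_cast h2.symm) h3
  · intro z
    have hz_int : IsIntegral ℤ ((z : Qd d) : ℂ) :=
      (NumberField.RingOfIntegers.isIntegral_coe z).algebraMap
    obtain ⟨x, y, h⟩ := hgen _ (z : Qd d).2 hz_int
    exact ⟨⟨x, y⟩, hval (by simp only; rw [hφ, h])⟩

theorem sqrtNeg_mem_Qd (d : ℕ) : Complex.I * (Real.sqrt d : ℂ) ∈ Qd d :=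
  IntermediateField.mem_adjoin_simple_self ℚ _

theorem nonempty_ringEquiv_even {d : ℕ} (hd : Squarefree d) (hd0 : 0 < d) (hmod : d % 4 ≠ 3) :
    Nonempty (Od d ≃+* QuadraticAlgebra ℤ (-d) 0) := by
  refine nonempty_ringEquiv_Od (sqrtNeg_mem_Qd d) (by rw [sqrtNeg_mul_self]; simp)
    (by simp [hd0.ne']) fun z hz hz_int => ?_
  obtain ⟨p, q, n, h, hz⟩ := exists_int_of_mem_Qd hd hz hz_int
  have h4 : ¬ 2 * 2 ∣ d := fun h => by
    have := Nat.isUnit_iff.1 (hd 2 h)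
    omega
  obtain ⟨m, hm⟩ : ∃ m : ℤ, (d : ℤ) = 4 * m + 1 ∨ (d : ℤ) = 4 * m + 2 := ⟨(d : ℤ) / 4, by omega⟩
  obtain ⟨x, rfl | rfl⟩ := p.even_or_odd' <;> obtain ⟨y, rfl | rfl⟩ := q.even_or_odd'
  · refine ⟨x, y, ?_⟩
    push_cast at hz
    linear_combination hz / 2
  all_goals
    exfalso
    rcases hm with hm | hm <;> rw [hm] at h <;> ring_nf at h <;> omega

theorem nonempty_ringEquiv_odd {d : ℕ} {k : ℤ} (hd : Squarefree d) (hk : (d : ℤ) = 4 * k - 1) :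
    Nonempty (Od d ≃+* QuadraticAlgebra ℤ (-k) 1) := by
  have hx := sqrtNeg_mul_self d
  have hk' : (d : ℂ) = 4 * k - 1 := by exact_mod_cast congrArg (fun t : ℤ => (t : ℂ)) hk
  have hd0 : d ≠ 0 := by omega
  refine nonempty_ringEquiv_Od (w := (1 + Complex.I * (Real.sqrt d : ℂ)) / 2)
    (div_mem (add_mem (one_mem _) (sqrtNeg_mem_Qd d)) (ofNat_mem _ 2)) ?_ (by simp [hd0])
    fun z hz hz_int => ?_
  · push_cast
    linear_combination hx / 4 - hk' / 4
  obtain ⟨p, q, n, h, hz⟩ := exists_int_of_mem_Qd hd hz hz_int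
  obtain ⟨x, hx⟩ : ∃ x, p = 2 * x + q := by
    rw [hk] at h
    obtain ⟨x, rfl | rfl⟩ := p.even_or_odd' <;> obtain ⟨y, rfl | rfl⟩ := q.even_or_odd'
    · exact ⟨x - y, by ring⟩
    · exfalso; ring_nf at h; omega
    · exfalso; ring_nf at h; omega
    · exact ⟨x - y, by ring⟩
  refine ⟨x, q, ?_⟩
  rw [hx] at hz
  push_cast at hz
  linear_combination hz / 2

end RingOfIntegers

section ProjectiveAction

open Matrix

theorem exists_congrAct_PSL2 {S R : Type} [CommRing S] [IsDomain S] [CommRing R] [StarRing R]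
    (e : S ≃+* R) :
    ∃ α : PSL2 S →* (Matrix (Fin 2) (Fin 2) R ≃ₗ[ℤ] Matrix (Fin 2) (Fin 2) R),
      (∀ g, ∃ s, α g = congrAct s) ∧ ∀ s, ∃ g, α g = congrAct s := by
  let ψ : SL2 S →* SL2 R := Matrix.SpecialLinearGroup.map (e : S →+* R)
  refine ⟨QuotientGroup.lift _ (congrAct.comp ψ) fun g hg => ?_, fun g => ?_, fun s => ?_⟩
  · obtain ⟨r, hr, hg⟩ := Matrix.SpecialLinearGroup.mem_center_iff.1 hg
    have hr' : r = 1 ∨ r = -1 := by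
      rw [Fintype.card_fin] at hr
      rwa [sq_eq_one_iff] at hr
    have hψ : (ψ g).1 = scalar (Fin 2) (e r) := by
      change g.1.map e = _
      rw [← hg]
      ext i j
      fin_cases i <;> fin_cases j <;> simp
    ext1 M
    change (ψ g).1 * M * (ψ g).1ᴴ = M
    rw [hψ]
    rcases hr' with rfl | rfl
    · simp
    · rw [map_neg, map_one, map_neg, map_one]
      simp
  · obtain ⟨g, rfl⟩ := QuotientGroup.mk_surjective g
    exact ⟨ψ g, rfl⟩
  · refine ⟨QuotientGroup.mk (Matrix.SpecialLinearGroup.map (e.symm : R →+* S) s), ?_⟩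
    change congrAct (ψ _) = _
    congr 1
    ext i j
    simp [ψ]

end ProjectiveAction

/-- For every squarefree positive integer `d ≠ 3`, the Bianchi group `PSL₂(O_d)` splits as
a nontrivial amalgamated free product. -/
theorem bianchi_amalgam_splitting (d : ℕ) (hd : Squarefree d) (hd0 : 0 < d) (h3 : d ≠ 3) :
    ∃ (A B C : GrpCat) (f : C →* A) (g : C →* B),
      Function.Injective f ∧ ¬ Function.Surjective f ∧
      Function.Injective g ∧ ¬ Function.Surjective g ∧
      Nonempty (PSL2 (Od d) ≃* AmalgamatedFreeProduct f g) := by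
  by_cases hmod : d % 4 = 3
  · obtain ⟨k, hk⟩ : ∃ k : ℤ, (d : ℤ) = 4 * k - 1 := ⟨((d : ℤ) + 1) / 4, by omega⟩
    obtain ⟨e⟩ := nonempty_ringEquiv_odd hd hk
    obtain ⟨α, hα, hα'⟩ := exists_congrAct_PSL2 e
    exact exists_amalgam_of_odd (by omega) α hα hα'
  · obtain ⟨e⟩ := nonempty_ringEquiv_even hd hd0 hmod
    obtain ⟨α, hα, hα'⟩ := exists_congrAct_PSL2 e
    exact exists_amalgam_of_even (by omega) α hα hα'
end

section
/- The Bianchi group PSL₂(O_3) does not split as a nontrivial amalgamated free product: for all groups A, B, C and all injective, non-surjective group homomorphisms f : C → A and g : C → B, the group PSL₂(O_3) is not isomorphic to the amalgamated free product A ∗_C B (the pushout of f and g in the category of groups). -/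
open IntermediateField

namespace Monoid.PushoutI

variable {G : Bool → Type*} {H : Type*} [∀ i, Group (G i)] [Group H] {φ : ∀ i, H →* G i}

/-- `StartsWith i x` says that `x` is the product of a nonempty reduced word whose first letter
lies in `G i`. -/
inductive StartsWith (φ : ∀ i, H →* G i) : Bool → PushoutI φ → Prop
  | single {i : Bool} {a : G i} (ha : a ∉ (φ i).range) : StartsWith φ i (of i a)
  | cons {i : Bool} {a : G i} {x : PushoutI φ} (ha : a ∉ (φ i).range)
      (hx : StartsWith φ (!i) x) : StartsWith φ i (of i a * x)

theorem StartsWith.exists_reduced {i : Bool} {x : PushoutI φ} (hx : StartsWith φ i x) :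
    ∃ w : CoprodI.Word G, Reduced φ w ∧ ofCoprodI w.prod = x ∧ w.fstIdx = some i := by
  classical
  induction hx with
  | @single i a ha =>
    have ha1 : a ≠ 1 := fun h => ha (h ▸ one_mem _)
    have hempty : (CoprodI.Word.empty : CoprodI.Word G).fstIdx ≠ some i := by
      simp [CoprodI.Word.fstIdx, CoprodI.Word.empty]
    refine ⟨CoprodI.Word.cons a CoprodI.Word.empty hempty ha1, ?_, ?_, ?_⟩
    · intro g hg
      simp [CoprodI.Word.cons, CoprodI.Word.empty] at hg
      subst hg
      exact ha
    · simp
    · simp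
  | @cons i a x ha _ ih =>
    have ha1 : a ≠ 1 := fun h => ha (h ▸ one_mem _)
    obtain ⟨w, hw, rfl, hi⟩ := ih
    refine ⟨CoprodI.Word.cons a w (by simp [hi]) ha1, ?_, ?_, ?_⟩
    · intro g hg
      simp only [CoprodI.Word.cons, List.mem_cons] at hg
      rcases hg with rfl | hg
      · exact ha
      · exact hw g hg
    · simp
    · simp

theorem StartsWith.ne_one (hφ : ∀ i, Function.Injective (φ i)) {i : Bool} {x : PushoutI φ}
    (hx : StartsWith φ i x) : x ≠ 1 := by
  rintro rfl
  obtain ⟨w, hw, hprod, hi⟩ := hx.exists_reduced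
  have := hw.eq_empty_of_mem_range hφ (hprod ▸ one_mem _)
  simp [this, CoprodI.Word.fstIdx, CoprodI.Word.empty] at hi

theorem StartsWith.base_mul {i : Bool} {x : PushoutI φ} (hx : StartsWith φ i x) (c : H) :
    StartsWith φ i (base φ c * x) := by
  have key {i : Bool} {a : G i} (ha : a ∉ (φ i).range) : φ i c * a ∉ (φ i).range := fun h =>
    ha ((Subgroup.mul_mem_cancel_left _ (MonoidHom.mem_range.2 ⟨c, rfl⟩)).1 h)
  cases hx with
  | single ha =>
    rw [← of_apply_eq_base φ i, ← map_mul]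
    exact .single (key ha)
  | cons ha hx =>
    rw [← mul_assoc, ← of_apply_eq_base φ i, ← map_mul]
    exact .cons (key ha) hx

theorem mem_range_base_or_startsWith (x : PushoutI φ) :
    x ∈ (base φ).range ∨ ∃ i, StartsWith φ i x := by
  have step (i : Bool) (a : G i) (x : PushoutI φ)
      (hx : x ∈ (base φ).range ∨ ∃ i, StartsWith φ i x) :
      of i a * x ∈ (base φ).range ∨ ∃ j, StartsWith φ j (of i a * x) := by
    by_cases ha : a ∈ (φ i).range
    · obtain ⟨c, rfl⟩ := ha
      rw [of_apply_eq_base φ i]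
      exact hx.imp (fun h => mul_mem ⟨c, rfl⟩ h) fun ⟨j, h⟩ => ⟨j, h.base_mul c⟩
    rcases hx with ⟨c, rfl⟩ | ⟨j, hx⟩
    · refine .inr ⟨i, ?_⟩
      rw [← of_apply_eq_base φ i, ← map_mul]
      exact .single fun h =>
        ha ((Subgroup.mul_mem_cancel_right _ (MonoidHom.mem_range.2 ⟨c, rfl⟩)).1 h)
    by_cases hij : j = i
    · subst hij
      cases hx with
      | @single _ b hb =>
        rw [← map_mul]
        by_cases hab : a * b ∈ (φ j).range
        · obtain ⟨c, hc⟩ := hab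
          rw [← hc, of_apply_eq_base φ j]
          exact .inl ⟨c, rfl⟩
        · exact .inr ⟨j, .single hab⟩
      | @cons _ b x hb hx =>
        rw [← mul_assoc, ← map_mul]
        by_cases hab : a * b ∈ (φ j).range
        · obtain ⟨c, hc⟩ := hab
          rw [← hc, of_apply_eq_base φ j]
          exact .inr ⟨_, hx.base_mul c⟩
        · exact .inr ⟨j, .cons hab hx⟩
    · obtain rfl : j = !i := Bool.eq_not.2 hij
      exact .inr ⟨i, .cons ha hx⟩
  suffices h : ∀ y : PushoutI φ, (y ∈ (base φ).range ∨ ∃ i, StartsWith φ i y) →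
      (x * y ∈ (base φ).range ∨ ∃ i, StartsWith φ i (x * y)) by
    simpa using h 1 (.inl (one_mem _))
  induction x using induction_on with
  | of i a => exact step i a
  | base c =>
    intro y hy
    exact hy.imp (fun h => mul_mem ⟨c, rfl⟩ h) fun ⟨j, h⟩ => ⟨j, h.base_mul c⟩
  | mul x y hx hy =>
    intro z hz
    rw [mul_assoc]
    exact hx _ (hy _ hz)

/-- `Carries i j x` says that left multiplication by `x` sends the amalgamated subgroup, and every
reduced word not starting in `G i`, to reduced words starting in `G j`. -/
def Carries (φ : ∀ i, H →* G i) (i j : Bool) (x : PushoutI φ) : Prop :=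
  ∀ y, (y ∈ (base φ).range ∨ StartsWith φ (!i) y) → StartsWith φ j (x * y)

theorem carries_of {i : Bool} {a : G i} (ha : a ∉ (φ i).range) : Carries φ i i (of i a) := by
  rintro y (⟨c, rfl⟩ | hy)
  · rw [← of_apply_eq_base φ i, ← map_mul]
    exact .single fun h =>
      ha ((Subgroup.mul_mem_cancel_right _ (MonoidHom.mem_range.2 ⟨c, rfl⟩)).1 h)
  · exact .cons ha hy

theorem StartsWith.exists_carries {j : Bool} {x : PushoutI φ} (hx : StartsWith φ j x) :
    ∃ i, Carries φ i j x := by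
  induction hx with
  | @single j a ha => exact ⟨j, carries_of ha⟩
  | @cons j a x ha _ ih =>
    obtain ⟨i, hi⟩ := ih
    exact ⟨i, fun y hy => mul_assoc (of j a) x y ▸ .cons ha (hi y hy)⟩

theorem Carries.mul {i j k : Bool} {x y : PushoutI φ} (hx : Carries φ j k x)
    (hy : Carries φ i (!j) y) : Carries φ i k (x * y) := fun z hz => by
  rw [mul_assoc]
  exact hx _ (.inr (hy z hz))

theorem Carries.not_isOfFinOrder (hφ : ∀ i, Function.Injective (φ i)) {i : Bool} {x : PushoutI φ}
    (hx : Carries φ (!i) i x) : ¬ IsOfFinOrder x := by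
  intro h
  obtain ⟨n, hn, hxn⟩ := isOfFinOrder_iff_pow_eq_one.1 h
  have hpow (n : ℕ) : StartsWith φ i (x ^ (n + 1)) := by
    induction n with
    | zero => simpa using hx 1 (.inl (one_mem _))
    | succ n ih =>
      rw [pow_succ']
      exact hx _ (.inr (by simpa using ih))
  obtain ⟨m, rfl⟩ := Nat.exists_eq_succ_of_ne_zero hn.ne'
  exact (hpow m).ne_one hφ hxn

theorem mem_range_base_or_carries_of_isOfFinOrder (hφ : ∀ i, Function.Injective (φ i))
    {x : PushoutI φ} (hx : IsOfFinOrder x) : x ∈ (base φ).range ∨ ∃ i, Carries φ i i x := by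
  refine (mem_range_base_or_startsWith x).imp_right fun ⟨j, hj⟩ => ?_
  obtain ⟨i, hi⟩ := hj.exists_carries
  by_cases hij : i = j
  · exact ⟨j, hij ▸ hi⟩
  · obtain rfl : i = !j := Bool.eq_not.2 hij
    exact absurd hx (hi.not_isOfFinOrder hφ)

theorem Carries.base_conj {i j : Bool} {x : PushoutI φ} (hx : Carries φ i j x) {c : PushoutI φ}
    (hc : c ∈ (base φ).range) : Carries φ i j (c⁻¹ * x * c) := by
  obtain ⟨c, rfl⟩ := hc
  intro y hy
  rw [mul_assoc, mul_assoc, ← map_inv]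
  exact (hx _ (hy.imp (fun h => mul_mem ⟨c, rfl⟩ h) fun h => h.base_mul c)).base_mul _

theorem Carries.eq_of_isOfFinOrder_mul (hφ : ∀ i, Function.Injective (φ i)) {i j : Bool}
    {x y : PushoutI φ} (hx : Carries φ i i x) (hy : Carries φ j j y)
    (hxy : IsOfFinOrder (x * y)) : i = j := by
  by_contra hij
  obtain rfl : j = !i := Bool.eq_not.2 (Ne.symm hij)
  exact (hx.mul hy).not_isOfFinOrder hφ hxy

/-- In tree terms: a group generated by elements such that they and their pairwise products are
elliptic fixes a vertex, which is impossible for a nontrivial amalgamated product acting on its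
Bass–Serre tree. -/
theorem closure_ne_top_of_isOfFinOrder_mul (hφ : ∀ i, Function.Injective (φ i))
    (hφ' : ∀ i, ¬ Function.Surjective (φ i)) (S : Set (PushoutI φ))
    (hS : ∀ s ∈ S, ∀ t ∈ S, IsOfFinOrder (s * t)) : Subgroup.closure S ≠ ⊤ := by
  intro htop
  have hconj (x s : PushoutI φ) (h : IsOfFinOrder s) : IsOfFinOrder (x⁻¹ * s * x) := by
    simpa using (MulAut.conj x⁻¹).toMonoidHom.isOfFinOrder h
  have hS1 : ∀ s ∈ S, IsOfFinOrder s := fun s hs =>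
    IsOfFinOrder.of_pow (n := 2) (by simpa [sq] using hS s hs s hs) two_ne_zero
  have hletter (i : Bool) : ∃ a : G i, a ∉ (φ i).range := by
    have h := hφ' i
    rw [← MonoidHom.range_eq_top, Subgroup.eq_top_iff'] at h
    push Not at h
    exact h
  have huniq {x s t : PushoutI φ} {i j : Bool} (hs : s ∈ S) (ht : t ∈ S)
      (hsi : Carries φ i i (x⁻¹ * s * x)) (htj : Carries φ j j (x⁻¹ * t * x)) : i = j := by
    refine hsi.eq_of_isOfFinOrder_mul hφ htj ?_
    convert hconj x _ (hS s hs t ht) using 1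
    group
  have hex (x : PushoutI φ) : ∃ i, ∃ s ∈ S, Carries φ i i (x⁻¹ * s * x) := by
    by_contra hcon
    push Not at hcon
    have hC : Subgroup.closure S ≤ (base φ).range.map (MulAut.conj x).toMonoidHom := by
      rw [Subgroup.closure_le]
      intro s hs
      rcases mem_range_base_or_carries_of_isOfFinOrder hφ (hconj x s (hS1 s hs)) with h | ⟨i, h⟩
      · exact ⟨_, h, by simp [mul_assoc]⟩
      · exact absurd h (hcon i s hs)
    obtain ⟨a, ha⟩ := hletter true
    rw [htop] at hC
    obtain ⟨y, hy, hxy⟩ := hC (Subgroup.mem_top (x * of true a * x⁻¹))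
    obtain rfl : y = of true a := by simpa using hxy
    obtain ⟨c, hc⟩ := hy
    rw [← of_apply_eq_base φ true] at hc
    exact ha ⟨c, of_injective hφ true hc⟩
  choose σ hσ using hex
  have hσ_gen (s : PushoutI φ) (hs : s ∈ S) (x : PushoutI φ) : σ (s * x) = σ x := by
    obtain ⟨t, ht, htx⟩ := hσ x
    obtain ⟨u, hu, hux⟩ := hσ (s * x)
    suffices h : ∃ v ∈ S, Carries φ (σ x) (σ x) ((s * x)⁻¹ * v * (s * x)) by
      obtain ⟨v, hv, hvx⟩ := h
      exact huniq hu hv hux hvx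
    rcases mem_range_base_or_carries_of_isOfFinOrder hφ (hconj x s (hS1 s hs)) with h | ⟨i, h⟩
    · refine ⟨t, ht, ?_⟩
      convert htx.base_conj h using 1
      group
    · obtain rfl := huniq hs ht h htx
      refine ⟨s, hs, ?_⟩
      convert h using 1
      group
  have hσ_const (x : PushoutI φ) : ∀ y, σ (x * y) = σ y := by
    have hx : x ∈ Subgroup.closure S := htop ▸ Subgroup.mem_top x
    induction hx using Subgroup.closure_induction with
    | mem s hs => exact hσ_gen s hs
    | one => simp
    | mul x y _ _ hx hy => exact fun z => by rw [mul_assoc, hx, hy]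
    | inv x _ hx => exact fun z => by rw [← hx (x⁻¹ * z), mul_inv_cancel_left]
  obtain ⟨b, hb⟩ := hletter (!σ 1)
  obtain ⟨s, hs, hs1⟩ := hσ 1
  obtain ⟨t, ht, htb⟩ := hσ (of (!σ 1) b)
  have hb' : b⁻¹ ∉ (φ (!σ 1)).range := fun h => hb (inv_mem_iff.1 h)
  rw [← mul_one (of (!σ 1) b), hσ_const, mul_one] at htb
  have ht1 : Carries φ (!σ 1) (!σ 1) (1⁻¹ * t * 1) := by
    have h := ((carries_of hb).mul (j := !σ 1) (y := _) (i := !σ 1)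
      ((by simpa using htb : Carries φ (σ 1) (!!σ 1) _).mul (carries_of hb')))
    convert h using 1
    simp only [map_inv]
    group
  exact absurd (huniq hs ht hs1 ht1) (by simp)

end Monoid.PushoutI

namespace Matrix.SpecialLinearGroup

variable {R : Type*} [CommRing R]

/-- The upper unitriangular matrix with off-diagonal entry `x`. -/
def upper (x : R) : SL2 R := ⟨!![1, x; 0, 1], by simp⟩

theorem coe_upper (x : R) : (upper x : Matrix (Fin 2) (Fin 2) R) = !![1, x; 0, 1] := rfl

/-- The matrix `!![0, -1; 1, 0]`. -/
def weyl : SL2 R := ⟨!![0, -1; 1, 0], by simp⟩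

theorem coe_weyl : ((weyl : SL2 R) : Matrix (Fin 2) (Fin 2) R) = !![0, -1; 1, 0] := rfl

theorem mem_of_forall_upper_mem_of_lower_left_eq_zero {P : Subgroup (SL2 R)} (hT : ∀ x, upper x ∈ P)
    (hw : weyl ∈ P) (M : SL2 R) (hM : M 1 0 = 0) : M ∈ P := by
  have hdet : M 0 0 * M 1 1 = 1 := by
    have h := M.det_coe
    rw [det_fin_two, hM] at h
    linear_combination h
  have key : M = upper (M 0 0) * (weyl * upper (M 1 1) * weyl⁻¹) * upper (M 0 0) * weyl
      * upper (M 1 1 * M 0 1) := by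
    ext i j
    fin_cases i <;> fin_cases j <;>
      simp [coe_upper, coe_weyl, Matrix.mul_apply, Fin.sum_univ_two, adjugate_fin_two, hM,
        SpecialLinearGroup.coe_inv] <;> grind
  rw [key]
  exact mul_mem (mul_mem (mul_mem (mul_mem (hT _) (mul_mem (mul_mem hw (hT _)) (inv_mem hw)))
    (hT _)) hw) (hT _)

/-- Over a ring with a Euclidean function, `SL₂` is generated by the upper unitriangular matrices
and `weyl`. -/
theorem eq_top_of_forall_upper_mem (N : R → ℕ)
    (hN : ∀ a b : R, b ≠ 0 → ∃ q, N (a - q * b) < N b) {P : Subgroup (SL2 R)}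
    (hT : ∀ x, upper x ∈ P) (hw : weyl ∈ P) : P = ⊤ := by
  rw [Subgroup.eq_top_iff']
  intro M
  induction h : N (M 1 0) using Nat.strong_induction_on generalizing M with
  | _ n ih =>
    by_cases h0 : M 1 0 = 0
    · exact mem_of_forall_upper_mem_of_lower_left_eq_zero hT hw M h0
    obtain ⟨q, hq⟩ := hN (M 0 0) (M 1 0) h0
    have hM : weyl * upper (-q) * M ∈ P := by
      refine ih _ (h ▸ hq) _ (congrArg N ?_)
      simp [coe_upper, coe_weyl, Matrix.mul_apply, Fin.sum_univ_two]
      ring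
    exact (Subgroup.mul_mem_cancel_left _ (mul_mem hw (hT _))).1 hM

variable {ω : R}

/-- The matrix `!![ω, x; 0, ω ^ 2]`, for `ω` a root of `X ^ 2 + X + 1`. -/
def borel (hω : ω ^ 2 + ω + 1 = 0) (x : R) : SL2 R :=
  ⟨!![ω, x; 0, ω ^ 2], by rw [det_fin_two_of]; linear_combination (ω - 1) * hω⟩

theorem coe_borel (hω : ω ^ 2 + ω + 1 = 0) (x : R) :
    (borel hω x : Matrix (Fin 2) (Fin 2) R) = !![ω, x; 0, ω ^ 2] := rfl

/-- The generators `borel 0`, `borel 1` and `weyl` of `SL₂(ℤ[ω])`. -/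
def eisensteinGenerators (hω : ω ^ 2 + ω + 1 = 0) : Set (SL2 R) :=
  {borel hω 0, borel hω 1, weyl}

theorem isOfFinOrder_of_trace (M : SL2 R)
    (h : M 0 0 + M 1 1 = 0 ∨ M 0 0 + M 1 1 = 1 ∨ M 0 0 + M 1 1 = -1) : IsOfFinOrder M := by
  have hdet := M.det_coe
  rw [det_fin_two] at hdet
  have hCH : (M : Matrix (Fin 2) (Fin 2) R) ^ 2 = (M 0 0 + M 1 1) • (M : Matrix _ _ R) - 1 := by
    ext i j
    fin_cases i <;> fin_cases j <;> simp [sq, Matrix.mul_apply, Fin.sum_univ_two] <;> grind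
  refine isOfFinOrder_iff_pow_eq_one.2 ⟨12, by norm_num, Subtype.ext ?_⟩
  rw [SpecialLinearGroup.coe_pow, SpecialLinearGroup.coe_one]
  generalize (M : Matrix (Fin 2) (Fin 2) R) = X at *
  rcases h with h | h | h <;> rw [h] at hCH
  · have h2 : X ^ 2 = -1 := by simpa using hCH
    rw [show 12 = 2 * 6 from rfl, pow_mul, h2]
    norm_num
  · have h3 : X ^ 3 = -1 := by
      have : X ^ 3 = X * X ^ 2 := pow_succ' X 2
      rw [this, hCH, one_smul, mul_sub, ← sq, hCH]
      simp
    rw [show 12 = 3 * 4 from rfl, pow_mul, h3]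
    norm_num
  · have h3 : X ^ 3 = 1 := by
      have : X ^ 3 = X * X ^ 2 := pow_succ' X 2
      rw [this, hCH, neg_one_smul, mul_sub, mul_neg, ← sq, hCH]
      simp
    rw [show 12 = 3 * 4 from rfl, pow_mul, h3, one_pow]

theorem isOfFinOrder_mul_of_mem_eisensteinGenerators (hω : ω ^ 2 + ω + 1 = 0) :
    ∀ s ∈ eisensteinGenerators hω, ∀ t ∈ eisensteinGenerators hω, IsOfFinOrder (s * t) := by
  have hbb (x y : R) : IsOfFinOrder (borel hω x * borel hω y) := by
    refine isOfFinOrder_of_trace _ (.inr (.inr ?_))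
    simp [coe_borel]
    linear_combination (ω ^ 2 - ω + 1) * hω
  have hbw (x : R) (hx : x = 0 ∨ x = 1) : IsOfFinOrder (borel hω x * weyl) := by
    refine isOfFinOrder_of_trace _ (hx.imp ?_ fun h => .inl ?_) <;>
      simp_all [coe_borel, coe_weyl]
  have hwb (x : R) (hx : x = 0 ∨ x = 1) : IsOfFinOrder (weyl * borel hω x) := by
    refine isOfFinOrder_of_trace _ (hx.imp ?_ fun h => .inl ?_) <;>
      simp_all [coe_borel, coe_weyl]
  have hww : IsOfFinOrder (weyl * weyl : SL2 R) := by
    rw [← sq]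
    refine IsOfFinOrder.pow (isOfFinOrder_of_trace _ (.inl ?_))
    simp [coe_weyl]
  rintro s (rfl | rfl | rfl) t (rfl | rfl | rfl)
  exacts [hbb 0 0, hbb 0 1, hbw 0 (.inl rfl), hbb 1 0, hbb 1 1, hbw 1 (.inr rfl),
    hwb 0 (.inl rfl), hwb 1 (.inr rfl), hww]

theorem closure_eisensteinGenerators (hω : ω ^ 2 + ω + 1 = 0)
    (hspan : ∀ x : R, ∃ m n : ℤ, x = m + n * ω) (N : R → ℕ)
    (hN : ∀ a b : R, b ≠ 0 → ∃ q, N (a - q * b) < N b) :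
    Subgroup.closure (eisensteinGenerators hω) = ⊤ := by
  set P := Subgroup.closure (eisensteinGenerators hω)
  have h0 : borel hω 0 ∈ P := Subgroup.subset_closure (by simp [eisensteinGenerators])
  have h1 : borel hω 1 ∈ P := Subgroup.subset_closure (by simp [eisensteinGenerators])
  have hw : weyl ∈ P := Subgroup.subset_closure (by simp [eisensteinGenerators])
  have hω3 : ω ^ 3 = 1 := by linear_combination (ω - 1) * hω
  let T : AddSubgroup R :=
    { carrier := {x | upper x ∈ P}
      zero_mem' := by
        have : upper (0 : R) = 1 := by ext i j; fin_cases i <;> fin_cases j <;> simp [coe_upper]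
        exact (congrArg (· ∈ P) this).mpr (one_mem P)
      add_mem' := fun {x y} hx hy => by
        have : upper (x + y) = upper x * upper y := by
          ext i j; fin_cases i <;> fin_cases j <;> simp [coe_upper, add_comm]
        exact (congrArg (· ∈ P) this).mpr (mul_mem hx hy)
      neg_mem' := fun {x} hx => by
        have : upper (-x) = (upper x)⁻¹ := by
          ext i j
          fin_cases i <;> fin_cases j <;>
            simp [coe_upper, SpecialLinearGroup.coe_inv, adjugate_fin_two]
        exact (congrArg (· ∈ P) this).mpr (inv_mem hx) }
  have hT2 : ω ^ 2 ∈ T := by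
    have : upper (ω ^ 2) = (borel hω 0)⁻¹ * borel hω 1 := by
      ext i j
      fin_cases i <;> fin_cases j <;>
        simp [coe_upper, coe_borel, SpecialLinearGroup.coe_inv, adjugate_fin_two] <;> grind
    exact (congrArg (· ∈ P) this).mpr <| mul_mem (inv_mem h0) h1
  have hTmul (x : R) (hx : x ∈ T) : ω ^ 2 * x ∈ T := by
    have : upper (ω ^ 2 * x) = borel hω 0 * upper x * (borel hω 0)⁻¹ := by
      ext i j
      fin_cases i <;> fin_cases j <;>
        simp [coe_upper, coe_borel, SpecialLinearGroup.coe_inv, adjugate_fin_two] <;> grind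
    exact (congrArg (· ∈ P) this).mpr <| mul_mem (mul_mem h0 hx) (inv_mem h0)
  have hTω : ω ∈ T := by
    convert hTmul _ hT2 using 1
    linear_combination -ω * hω3
  have hT1 : 1 ∈ T := by
    convert hTmul _ hTω using 1
    linear_combination -hω3
  refine eq_top_of_forall_upper_mem N hN (fun x => ?_) hw
  obtain ⟨m, n, rfl⟩ := hspan x
  change m + n * ω ∈ T
  simpa [zsmul_eq_mul] using add_mem (zsmul_mem hT1 m) (zsmul_mem hTω n)

end Matrix.SpecialLinearGroup

namespace Eisenstein

theorem I_mul_sqrt_three_sq : (Complex.I * (Real.sqrt (3 : ℕ) : ℂ)) ^ 2 = -3 := by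
  rw [mul_pow, Complex.I_sq, ← Complex.ofReal_pow, Real.sq_sqrt (by positivity)]
  simp

theorem exists_rat_of_mem_Qd_three {x : ℂ} (hx : x ∈ Qd 3) :
    ∃ a b : ℚ, x = a + b * (Complex.I * (Real.sqrt (3 : ℕ) : ℂ)) := by
  have hθ := I_mul_sqrt_three_sq
  set θ : ℂ := Complex.I * (Real.sqrt (3 : ℕ) : ℂ)
  induction hx using IntermediateField.adjoin_induction with
  | mem x hx =>
    obtain rfl : x = θ := hx
    exact ⟨0, 1, by simp⟩
  | algebraMap q => exact ⟨q, 0, by simp⟩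
  | add x y _ _ hx hy =>
    obtain ⟨a, b, rfl⟩ := hx
    obtain ⟨c, d, rfl⟩ := hy
    exact ⟨a + c, b + d, by push_cast; ring⟩
  | mul x y _ _ hx hy =>
    obtain ⟨a, b, rfl⟩ := hx
    obtain ⟨c, d, rfl⟩ := hy
    exact ⟨a * c - 3 * b * d, a * d + b * c, by push_cast; linear_combination b * d * hθ⟩
  | inv x _ hx =>
    obtain ⟨a, b, rfl⟩ := hx
    by_cases h : a ^ 2 + 3 * b ^ 2 = 0
    · obtain rfl : a = 0 := by nlinarith [sq_nonneg a, sq_nonneg b]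
      obtain rfl : b = 0 := by nlinarith [sq_nonneg b]
      exact ⟨0, 0, by simp⟩
    · refine ⟨a / (a ^ 2 + 3 * b ^ 2), -b / (a ^ 2 + 3 * b ^ 2), inv_eq_of_mul_eq_one_right ?_⟩
      have h' : (a : ℂ) ^ 2 + 3 * b ^ 2 ≠ 0 := by exact_mod_cast h
      push_cast
      calc _ = ((a : ℂ) ^ 2 - b ^ 2 * θ ^ 2) / (a ^ 2 + 3 * b ^ 2) := by ring
        _ = 1 := (div_eq_one_iff_eq h').2 (by linear_combination -(b : ℂ) ^ 2 * hθ)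

theorem normSq_rat (a b : ℚ) :
    Complex.normSq (a + b * (Complex.I * (Real.sqrt (3 : ℕ) : ℂ))) = a ^ 2 + 3 * b ^ 2 := by
  have h : Real.sqrt 3 * Real.sqrt 3 = 3 := Real.mul_self_sqrt (by norm_num)
  simp [Complex.normSq_apply]
  linear_combination (b : ℝ) ^ 2 * h

/-- The primitive cube root of unity `(-1 + √-3) / 2`. -/
noncomputable def omegaC : ℂ := (-1 + Complex.I * (Real.sqrt (3 : ℕ) : ℂ)) / 2

theorem omegaC_relation : omegaC ^ 2 + omegaC + 1 = 0 := by
  rw [omegaC]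
  linear_combination I_mul_sqrt_three_sq / 4

theorem omegaC_mem : omegaC ∈ Qd 3 := by
  have h := IntermediateField.mem_adjoin_simple_self ℚ (Complex.I * (Real.sqrt (3 : ℕ) : ℂ))
  exact div_mem (add_mem (neg_mem (one_mem _)) h) (ofNat_mem _ 2)

/-- The primitive cube root of unity in `O_3`. -/
noncomputable def omega : Od 3 :=
  ⟨⟨omegaC, omegaC_mem⟩, Polynomial.X ^ 2 + Polynomial.X + 1, by monicity!, by
    simpa [Subtype.ext_iff] using omegaC_relation⟩

/-- The inclusion of `O_3` in `ℂ`. -/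
noncomputable def toComplex : Od 3 →+* ℂ :=
  (algebraMap (Qd 3) ℂ).comp (algebraMap (Od 3) (Qd 3))

theorem toComplex_injective : Function.Injective toComplex :=
  (algebraMap (Qd 3) ℂ).injective.comp NumberField.RingOfIntegers.coe_injective

theorem toComplex_mem (x : Od 3) : toComplex x ∈ Qd 3 := (x : Qd 3).2

theorem toComplex_omega : toComplex omega = omegaC := rfl

theorem omega_relation : omega ^ 2 + omega + 1 = 0 :=
  toComplex_injective (by simpa [toComplex_omega] using omegaC_relation)

theorem exists_normSq_sub_lt_one {x : ℂ} (hx : x ∈ Qd 3) :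
    ∃ m n : ℤ, Complex.normSq (x - (m + n * omegaC)) < 1 := by
  obtain ⟨a, b, rfl⟩ := exists_rat_of_mem_Qd_three hx
  refine ⟨round (a + b), round (2 * b), ?_⟩
  set m := round (a + b)
  set n := round (2 * b)
  have hm := abs_le.1 (abs_sub_round (a + b))
  have hn := abs_le.1 (abs_sub_round (2 * b))
  have key : (a : ℂ) + b * (Complex.I * (Real.sqrt (3 : ℕ) : ℂ)) - (m + n * omegaC) =
      ((a - m + n / 2 : ℚ) : ℂ) + ((b - n / 2 : ℚ) : ℂ) *
        (Complex.I * (Real.sqrt (3 : ℕ) : ℂ)) := by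
    rw [omegaC]
    push_cast
    ring
  rw [key, normSq_rat]
  have : (a - m + n / 2) ^ 2 + 3 * (b - n / 2) ^ 2 < 1 := by
    set u := a + b - m with hu
    set v := 2 * b - n with hv
    have : (a - m + n / 2) ^ 2 + 3 * (b - n / 2) ^ 2 = u ^ 2 - u * v + v ^ 2 := by
      rw [hu, hv]; ring
    rw [this]
    have hu2 : u ^ 2 ≤ 1 / 4 := by nlinarith
    have hv2 : v ^ 2 ≤ 1 / 4 := by nlinarith
    nlinarith [sq_nonneg (u + v)]
  exact_mod_cast this

theorem exists_nat_normSq (x : Od 3) : ∃ n : ℕ, Complex.normSq (toComplex x) = n := by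
  have hintegral : IsIntegral ℤ (toComplex x) :=
    (NumberField.RingOfIntegers.isIntegral x).map (toComplex.toIntAlgHom)
  have hconj : IsIntegral ℤ (starRingEnd ℂ (toComplex x)) :=
    hintegral.map (starRingEnd ℂ).toIntAlgHom
  have hmul := hintegral.mul hconj
  obtain ⟨a, b, hab⟩ := exists_rat_of_mem_Qd_three (toComplex_mem x)
  have hq : Complex.normSq (toComplex x) = ((a ^ 2 + 3 * b ^ 2 : ℚ) : ℝ) := by
    rw [hab, normSq_rat]
    push_cast
    rfl
  rw [Complex.mul_conj, hq] at hmul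
  have hmul' : IsIntegral ℤ (a ^ 2 + 3 * b ^ 2 : ℚ) := by
    refine (isIntegral_algebraMap_iff (algebraMap ℚ ℂ).injective).1 ?_
    simpa using hmul
  obtain ⟨k, hk⟩ := IsIntegrallyClosed.isIntegral_iff.1 hmul'
  have hk0 : 0 ≤ k := by
    have : (0 : ℚ) ≤ k := by
      rw [eq_intCast] at hk
      rw [hk]
      positivity
    exact_mod_cast this
  refine ⟨k.toNat, ?_⟩
  rw [hq, ← hk, eq_intCast, Rat.cast_intCast]
  exact_mod_cast (Int.toNat_of_nonneg hk0).symm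

theorem exists_int_eq (x : Od 3) : ∃ m n : ℤ, x = m + n * omega := by
  obtain ⟨m, n, h⟩ := exists_normSq_sub_lt_one (toComplex_mem x)
  refine ⟨m, n, sub_eq_zero.1 (toComplex_injective ?_)⟩
  obtain ⟨k, hk⟩ := exists_nat_normSq (x - (m + n * omega))
  have hsub : toComplex (x - (m + n * omega)) = toComplex x - (m + n * omegaC) := by
    simp [toComplex_omega]
  rw [hsub] at hk
  have hk0 : k = 0 := by
    rw [hk] at h
    have : k < 1 := by exact_mod_cast h
    omega
  rw [hsub, map_zero, ← Complex.normSq_eq_zero, hk, hk0, Nat.cast_zero]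

theorem exists_euclidean_function :
    ∃ N : Od 3 → ℕ, ∀ a b : Od 3, b ≠ 0 → ∃ q, N (a - q * b) < N b := by
  choose N hN using exists_nat_normSq
  refine ⟨N, fun a b hb => ?_⟩
  have hb' : toComplex b ≠ 0 := (map_ne_zero_iff _ toComplex_injective).2 hb
  obtain ⟨m, n, h⟩ := exists_normSq_sub_lt_one (div_mem (toComplex_mem a) (toComplex_mem b))
  refine ⟨m + n * omega, ?_⟩
  have key : toComplex (a - (m + n * omega) * b) =
      (toComplex a / toComplex b - (m + n * omegaC)) * toComplex b := by
    simp only [map_sub, map_mul, map_add, map_intCast, toComplex_omega]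
    field_simp
  have hlt : (N (a - (m + n * omega) * b) : ℝ) < N b := by
    rw [← hN, ← hN, key, map_mul]
    exact mul_lt_of_lt_one_left (Complex.normSq_pos.2 hb') h
  exact_mod_cast hlt

end Eisenstein

/-- The Bianchi group `PSL₂(O_3)` does not split as a nontrivial amalgamated free
product. -/
theorem bianchi_three_no_amalgam_splitting :
    ∀ (A B C : GrpCat) (f : C →* A) (g : C →* B),
      Function.Injective f → ¬ Function.Surjective f →
      Function.Injective g → ¬ Function.Surjective g →
      IsEmpty (PSL2 (Od 3) ≃* AmalgamatedFreeProduct f g) := by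
  intro A B C f g hf hf' hg hg'
  refine ⟨fun e => ?_⟩
  let φ : ∀ i : Bool, C →* AmalgamFam A B i :=
    fun i => Bool.rec (motive := fun i => C →* AmalgamFam A B i) g f i
  let e' : PSL2 (Od 3) ≃* Monoid.PushoutI φ := e
  let π : SL2 (Od 3) →* Monoid.PushoutI φ :=
    e'.toMonoidHom.comp (QuotientGroup.mk' (Subgroup.center (SL2 (Od 3))))
  have hπ : Function.Surjective π := e'.surjective.comp (QuotientGroup.mk'_surjective _)
  obtain ⟨N, hN⟩ := Eisenstein.exists_euclidean_function
  have hω := Eisenstein.omega_relation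
  refine Monoid.PushoutI.closure_ne_top_of_isOfFinOrder_mul (φ := φ) (Bool.rec hg hf)
    (Bool.rec hg' hf') (π '' Matrix.SpecialLinearGroup.eisensteinGenerators hω) ?_ ?_
  · rintro _ ⟨s, hs, rfl⟩ _ ⟨t, ht, rfl⟩
    rw [← map_mul]
    exact π.isOfFinOrder
      (Matrix.SpecialLinearGroup.isOfFinOrder_mul_of_mem_eisensteinGenerators hω s hs t ht)
  · rw [← MonoidHom.map_closure, Matrix.SpecialLinearGroup.closure_eisensteinGenerators hω
      Eisenstein.exists_int_eq N hN, ← MonoidHom.range_eq_map, MonoidHom.range_eq_top.2 hπ]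
end
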